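/- arXiv:math/0407322 — 2 statements merged into one kernel-verified Lean document; each statement's English description precedes it below -/
import Mathlib

section
/- Local limit theorem: assume condition (exp). Then, with σ = σ_n, ∫_0^1 φ(α) e^{−2πiαn} dα ∼ (2π B_n²)^{−1/2} as n → ∞; i.e. the limit of √(2π B_n²) · ∫_0^1 φ(α) e^{−2πiαn} dα equals 1 (the integral being real and positive for large n). -/
open Finset Filter

/-- The number of multisets of total size `n` determined by the parameters `a j`
(the number of one-component multisets of size `j`), i.e.
`c_n = Σ_{η ∈ Ω_n} Π_{j=1}^n C(a_j + η_j - 1, η_j)` where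
`Ω_n = {η : Σ_{j=1}^n j·η_j = n}` (indices shifted: `j ∈ Fin n` stands for `j+1`). -/
def multisetCount (a : ℕ → ℕ) (n : ℕ) : ℕ :=
  ∑ η : Fin n → Fin (n + 1),
    if ∑ j : Fin n, (j.1 + 1) * (η j).1 = n then
      ∏ j : Fin n, Nat.choose (a (j.1 + 1) + (η j).1 - 1) (η j).1
    else 0

/-- `M_n(σ) = Σ_{j=1}^n j a_j e^{-jσ}/(1-e^{-jσ})`. -/
noncomputable def Mfun (a : ℕ → ℕ) (n : ℕ) (σ : ℝ) : ℝ :=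
  ∑ j ∈ Finset.Icc 1 n, (j : ℝ) * (a j) * Real.exp (-(j * σ)) / (1 - Real.exp (-(j * σ)))

/-- `B_n²(σ) = Σ_{j=1}^n j² a_j e^{-jσ}/(1-e^{-jσ})²`. -/
noncomputable def B2 (a : ℕ → ℕ) (n : ℕ) (σ : ℝ) : ℝ :=
  ∑ j ∈ Finset.Icc 1 n, (j : ℝ) ^ 2 * (a j) * Real.exp (-(j * σ)) / (1 - Real.exp (-(j * σ))) ^ 2

/-- The characteristic function `φ(α) = Π_{j=1}^n ((1-e^{-jσ})/(1-e^{-jσ}e^{2πiαj}))^{a_j}`. -/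
noncomputable def phi (a : ℕ → ℕ) (n : ℕ) (σ : ℝ) (α : ℝ) : ℂ :=
  ∏ j ∈ Finset.Icc 1 n,
    (((1 - Real.exp (-(j * σ)) : ℝ) : ℂ) /
      (1 - ((Real.exp (-(j * σ)) : ℝ) : ℂ) *
        Complex.exp (2 * Real.pi * Complex.I * α * j))) ^ (a j)

/-- Condition (exp): `a_j ≍ j^{r-1} y^j`, i.e. there are constants `D₁, D₂ > 0` with
`D₁ j^{r-1} y^j ≤ a_j ≤ D₂ j^{r-1} y^j` for all `j ≥ 1`. -/
def ExpansiveCond (a : ℕ → ℕ) (r y : ℝ) : Prop :=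
  ∃ D₁ D₂ : ℝ, 0 < D₁ ∧ 0 < D₂ ∧ ∀ j : ℕ, 1 ≤ j →
    D₁ * (j : ℝ) ^ (r - 1) * y ^ j ≤ (a j : ℝ) ∧ (a j : ℝ) ≤ D₂ * (j : ℝ) ^ (r - 1) * y ^ j


noncomputable def Tk (a : ℕ → ℕ) (n : ℕ) (σ : ℝ) (k : ℕ) : ℝ :=
  ∑ j ∈ Finset.Icc 1 n, (a j : ℝ) * Real.exp (-(j * σ)) * ((j : ℝ) / (1 - Real.exp (-(j * σ)))) ^ k

lemma Mfun_eq (a : ℕ → ℕ) (n : ℕ) (σ : ℝ) : Mfun a n σ = Tk a n σ 1 := by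
  unfold Mfun Tk
  refine Finset.sum_congr rfl fun j _ => ?_
  ring

lemma B2_eq (a : ℕ → ℕ) (n : ℕ) (σ : ℝ) : B2 a n σ = Tk a n σ 2 := by
  unfold B2 Tk
  refine Finset.sum_congr rfl fun j _ => ?_
  rw [div_pow]; ring

lemma rpow_le_exp_half (s x : ℝ) (hs : 0 < s) (hx : 0 ≤ x) :
    x ^ s ≤ (2 * s) ^ s * Real.exp (x / 2) := by
  have h1 : x / (2 * s) ≤ Real.exp (x / (2 * s)) := by
    have := Real.add_one_le_exp (x / (2 * s)); linarith
  have h2 : (x / (2 * s)) ^ s ≤ (Real.exp (x / (2 * s))) ^ s :=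
    Real.rpow_le_rpow (by positivity) h1 hs.le
  rw [Real.div_rpow hx (by positivity), ← Real.exp_mul, div_le_iff₀ (by positivity)] at h2
  have : x / (2 * s) * s = x / 2 := by field_simp
  rw [this] at h2
  linarith

lemma pow_sub_bound (r : ℝ) (hr : 0 < r) (j : ℕ) :
    ((j + 1 : ℕ) : ℝ) ^ (r - 1) ≤ (1 + 1 / r) * (((j + 1 : ℕ) : ℝ) ^ r - (j : ℝ) ^ r) := by
  set x : ℝ := ((j + 1 : ℕ) : ℝ) with hx
  have hx1 : 1 ≤ x := by rw [hx]; push_cast; linarith [(Nat.cast_nonneg j : (0:ℝ) ≤ j)]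
  have hx0 : 0 < x := by linarith
  have hj : (j : ℝ) = x * (1 + -(1 / x)) := by rw [hx]; push_cast; field_simp; ring
  have hz : 0 ≤ 1 + -(1 / x) := by
    have : 1 / x ≤ 1 := by rw [div_le_one hx0]; exact hx1
    linarith
  rw [hj, Real.mul_rpow hx0.le hz]
  have hxr : x ^ (r - 1) = x ^ r / x := by rw [Real.rpow_sub hx0, Real.rpow_one]
  have hxp : 0 < x ^ r := by positivity
  rcases le_total r 1 with h | h
  · have := rpow_one_add_le_one_add_mul_self (s := -(1 / x)) (by linarith) hr.le h
    have h2 : r * (1 / x) ≤ 1 - (1 + -(1 / x)) ^ r := by linarith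
    have h3 : 1 / x ≤ (1 + 1 / r) * (1 - (1 + -(1 / x)) ^ r) := by
      calc 1 / x ≤ (1 + 1 / r) * (r * (1 / x)) := by
            have : (1 + 1 / r) * (r * (1 / x)) = 1 / x + r * (1 / x) := by field_simp; ring
            rw [this]; have : 0 < r * (1 / x) := by positivity
            linarith
        _ ≤ _ := by gcongr
    rw [hxr]
    calc x ^ r / x = x ^ r * (1 / x) := by ring
      _ ≤ x ^ r * ((1 + 1 / r) * (1 - (1 + -(1 / x)) ^ r)) := by gcongr
      _ = _ := by ring
  · have : (1 + -(1 / x)) ^ r ≤ (1 + -(1 / x)) ^ (1:ℝ) := by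
      apply Real.rpow_le_rpow_of_exponent_ge' hz _ (by norm_num) h
      have : 0 < 1 / x := by positivity
      linarith
    rw [Real.rpow_one] at this
    have h3 : 1 / x ≤ (1 + 1 / r) * (1 - (1 + -(1 / x)) ^ r) := by
      have h4 : 0 < 1 / x := by positivity
      have h5 : 0 < 1 / r := by positivity
      nlinarith
    rw [hxr]
    calc x ^ r / x = x ^ r * (1 / x) := by ring
      _ ≤ x ^ r * ((1 + 1 / r) * (1 - (1 + -(1 / x)) ^ r)) := by gcongr
      _ = _ := by ring

lemma abel_aux (b : ℕ → ℝ) (x : ℝ) (hb : b 0 = 0) (n : ℕ) :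
    ∑ j ∈ Finset.range n, (b (j + 1) - b j) * x ^ (j + 1)
      = b n * x ^ n + (1 - x) * ∑ j ∈ Finset.range n, b j * x ^ j := by
  induction n with
  | zero => simp [hb]
  | succ n ih => rw [Finset.sum_range_succ, ih, Finset.sum_range_succ]; ring

lemma S_bound (r : ℝ) (hr : 0 < r) : ∃ C : ℝ, 0 < C ∧ ∀ (δ : ℝ), 0 < δ → ∀ n : ℕ,
    ∑ j ∈ Finset.Icc 1 n, (j : ℝ) ^ (r - 1) * Real.exp (-(j * δ)) ≤ C * (δ⁻¹) ^ r := by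
  refine ⟨(1 + 1 / r) * (3 * (2 * r) ^ r), by positivity, fun δ hδ n => ?_⟩
  set x := Real.exp (-δ) with hx
  have hxpow : ∀ j : ℕ, Real.exp (-(j * δ)) = x ^ j := by
    intro j; rw [hx, ← Real.exp_nat_mul]; congr 1; ring
  set z := Real.exp (-(δ / 2)) with hz
  have hz0 : 0 < z := Real.exp_pos _
  have hz1 : z < 1 := by rw [hz, Real.exp_lt_one_iff]; linarith
  have hxz : x = z ^ 2 := by rw [hx, hz, ← Real.exp_nat_mul]; congr 1; push_cast; ring
  have hkey : ∀ j : ℕ, (j : ℝ) ^ r * x ^ j ≤ (2 * r) ^ r * (δ⁻¹) ^ r * z ^ j := by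
    intro j
    have h := rpow_le_exp_half r (j * δ) hr (by positivity)
    rw [Real.mul_rpow (by positivity) hδ.le] at h
    have h2 : Real.exp (j * δ / 2) * z ^ j = 1 := by
      rw [hz, ← Real.exp_nat_mul, ← Real.exp_add, Real.exp_eq_one_iff]; ring
    have h3 : (δ⁻¹) ^ r * δ ^ r = 1 := by
      rw [← Real.mul_rpow (by positivity) hδ.le, inv_mul_cancel₀ hδ.ne', Real.one_rpow]
    calc (j : ℝ) ^ r * x ^ j = (δ⁻¹) ^ r * δ ^ r * (j : ℝ) ^ r * x ^ j := by rw [h3]; ring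
      _ = ((j : ℝ) ^ r * δ ^ r) * ((δ⁻¹) ^ r * x ^ j) := by ring
      _ ≤ ((2 * r) ^ r * Real.exp (j * δ / 2)) * ((δ⁻¹) ^ r * x ^ j) := by gcongr
      _ = (2 * r) ^ r * (δ⁻¹) ^ r * z ^ j * (Real.exp (j * δ / 2) * z ^ j) := by rw [hxz]; ring
      _ = _ := by rw [h2, mul_one]
  have hE : ∑ j ∈ Finset.Icc 1 n, (j : ℝ) ^ (r - 1) * Real.exp (-(j * δ))
      = ∑ j ∈ Finset.range n, ((j + 1 : ℕ) : ℝ) ^ (r - 1) * x ^ (j + 1) := by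
    rw [Finset.range_eq_Ico, Finset.sum_Ico_add' (fun j : ℕ => (j : ℝ) ^ (r - 1) * x ^ j) 0 n 1]
    refine Finset.sum_congr (by ext; simp) fun j _ => by rw [hxpow]
  rw [hE]
  have hA := abel_aux (fun j => (j : ℝ) ^ r) x (by simp [hr.ne']) n
  calc _ ≤ ∑ j ∈ Finset.range n, (1 + 1 / r) * ((((j + 1 : ℕ) : ℝ) ^ r - (j : ℝ) ^ r) * x ^ (j + 1)) := by
        refine Finset.sum_le_sum fun j _ => ?_
        rw [← mul_assoc]
        exact mul_le_mul_of_nonneg_right (pow_sub_bound r hr j) (by positivity)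
    _ = (1 + 1 / r) * ((n : ℝ) ^ r * x ^ n + (1 - x) * ∑ j ∈ Finset.range n, (j : ℝ) ^ r * x ^ j) := by
        rw [← Finset.mul_sum]; rw [hA]
    _ ≤ (1 + 1 / r) * ((2 * r) ^ r * (δ⁻¹) ^ r * 1 + (1 - x) * ∑ j ∈ Finset.range n, (2 * r) ^ r * (δ⁻¹) ^ r * z ^ j) := by
        have hx1 : 0 ≤ 1 - x := by rw [hxz]; nlinarith
        refine mul_le_mul_of_nonneg_left (add_le_add ?_ (mul_le_mul_of_nonneg_left
          (Finset.sum_le_sum fun j _ => hkey j) hx1)) (by positivity)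
        exact (hkey n).trans (mul_le_mul_of_nonneg_left (pow_le_one₀ hz0.le hz1.le) (by positivity))
    _ = (1 + 1 / r) * ((2 * r) ^ r * (δ⁻¹) ^ r * (1 + (1 + z) * ((1 - z) * ∑ j ∈ Finset.range n, z ^ j))) := by
        rw [← Finset.mul_sum, hxz]; ring
    _ ≤ (1 + 1 / r) * ((2 * r) ^ r * (δ⁻¹) ^ r * 3) := by
        gcongr
        rw [mul_neg_geom_sum]
        have : 0 < z ^ n := by positivity
        have : (1 + z) * (1 - z ^ n) ≤ 2 * 1 := by
          have h1 : z ^ n ≤ 1 := pow_le_one₀ hz0.le hz1.le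
          nlinarith
        linarith
    _ = _ := by ring

lemma exp_w (y σ : ℝ) (hy : 1 ≤ y) (j : ℕ) :
    y ^ j * Real.exp (-(j * σ)) = Real.exp (-(j * (σ - Real.log y))) := by
  have : y = Real.exp (Real.log y) := (Real.exp_log (by linarith)).symm
  rw [show y ^ j = Real.exp (j * Real.log y) by rw [Real.exp_nat_mul, ← this], ← Real.exp_add]
  congr 1; ring

lemma div_one_sub_exp_le (δ σ : ℝ) (hδ : 0 < δ) (h : δ ≤ σ) (j : ℕ) (hj : 1 ≤ j) :
    (j : ℝ) / (1 - Real.exp (-(j * σ))) ≤ δ⁻¹ * (1 + j * δ) := by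
  have hj' : (1 : ℝ) ≤ j := by exact_mod_cast hj
  have hm : (j : ℝ) * δ ≤ j * σ := by gcongr
  have hp : 0 < (j : ℝ) * δ := by positivity
  have h1 : Real.exp (-(j * σ)) ≤ Real.exp (-(j * δ)) := Real.exp_le_exp.2 (by linarith)
  have h2 : Real.exp (-(j * δ)) ≤ 1 / (1 + j * δ) := by
    rw [Real.exp_neg, ← one_div]
    apply one_div_le_one_div_of_le (by positivity)
    linarith [Real.add_one_le_exp ((j : ℝ) * δ)]
  have h3 : (j : ℝ) * δ / (1 + j * δ) ≤ 1 - Real.exp (-(j * σ)) := by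
    have : (j : ℝ) * δ / (1 + j * δ) = 1 - 1 / (1 + j * δ) := by field_simp; ring
    rw [this]; linarith
  calc (j : ℝ) / (1 - Real.exp (-(j * σ))) ≤ j / ((j : ℝ) * δ / (1 + j * δ)) := by gcongr
    _ = _ := by field_simp

lemma T_bound (a : ℕ → ℕ) (r y D₂ : ℝ) (hr : 0 < r) (hy : 1 ≤ y) (hD : 0 < D₂)
    (hb : ∀ j : ℕ, 1 ≤ j → (a j : ℝ) ≤ D₂ * (j : ℝ) ^ (r - 1) * y ^ j) (k : ℕ) (hk : 1 ≤ k) :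
    ∃ C : ℝ, 0 < C ∧ ∀ (n : ℕ) (σ : ℝ), 0 < σ - Real.log y →
      Tk a n σ k ≤ C * ((σ - Real.log y)⁻¹ ^ r * (σ - Real.log y)⁻¹ ^ k) := by
  obtain ⟨C, hC, hS⟩ := S_bound r hr
  have hk0 : (0:ℝ) < k := by exact_mod_cast hk
  set K : ℝ := (2 * (k:ℝ)) ^ (k:ℝ) * Real.exp (1 / 2) with hK
  have hKpos : 0 < K := by positivity
  refine ⟨D₂ * K * C * 2 ^ r, by positivity, fun n σ hδ => ?_⟩
  set δ := σ - Real.log y with hδd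
  have hδσ : δ ≤ σ := by have := Real.log_nonneg hy; linarith
  have hK2 : ∀ x : ℝ, 0 ≤ x → (1 + x) ^ k ≤ K * Real.exp (x / 2) := by
    intro x hx
    have := rpow_le_exp_half k (1 + x) hk0 (by linarith)
    rw [Real.rpow_natCast] at this
    rw [hK, mul_assoc, ← Real.exp_add]
    convert this using 3
    ring
  have hterm : ∀ j ∈ Finset.Icc 1 n, (a j : ℝ) * Real.exp (-(j * σ)) *
      ((j : ℝ) / (1 - Real.exp (-(j * σ)))) ^ k ≤
      D₂ * K * δ⁻¹ ^ k * ((j : ℝ) ^ (r - 1) * Real.exp (-(j * (δ / 2)))) := by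
    intro j hj
    have hj1 : 1 ≤ j := (Finset.mem_Icc.1 hj).1
    have hj' : (1 : ℝ) ≤ j := by exact_mod_cast hj1
    have hd0 : 0 ≤ (j : ℝ) / (1 - Real.exp (-(j * σ))) := by
      apply div_nonneg (by positivity)
      rw [sub_nonneg, Real.exp_le_one_iff]
      have : 0 < (j:ℝ) * σ := mul_pos (by linarith) (by linarith)
      linarith
    have h1 : (a j : ℝ) * Real.exp (-(j * σ)) ≤ D₂ * (j : ℝ) ^ (r - 1) * Real.exp (-(j * δ)) := by
      rw [hδd, ← exp_w y σ hy, ← mul_assoc]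
      gcongr
      exact hb j hj1
    have h2 := pow_le_pow_left₀ hd0 (div_one_sub_exp_le δ σ hδ hδσ j hj1) k
    calc _ ≤ (D₂ * (j : ℝ) ^ (r - 1) * Real.exp (-(j * δ))) * (δ⁻¹ * (1 + j * δ)) ^ k := by gcongr
      _ = D₂ * (j : ℝ) ^ (r - 1) * Real.exp (-(j * δ)) * δ⁻¹ ^ k * (1 + j * δ) ^ k := by
          rw [mul_pow]; ring
      _ ≤ D₂ * (j : ℝ) ^ (r - 1) * Real.exp (-(j * δ)) * δ⁻¹ ^ k * (K * Real.exp (j * δ / 2)) := by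
          gcongr
          exact hK2 _ (by positivity)
      _ = D₂ * K * δ⁻¹ ^ k * ((j : ℝ) ^ (r - 1) * (Real.exp (-(j * δ)) * Real.exp (j * δ / 2))) := by ring
      _ = _ := by rw [← Real.exp_add]; congr 4; ring
  calc Tk a n σ k ≤ _ := Finset.sum_le_sum hterm
    _ = D₂ * K * δ⁻¹ ^ k * ∑ j ∈ Finset.Icc 1 n, ((j : ℝ) ^ (r - 1) * Real.exp (-(j * (δ / 2)))) := by
        rw [Finset.mul_sum]
    _ ≤ D₂ * K * δ⁻¹ ^ k * (C * (δ / 2)⁻¹ ^ r) := by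
        gcongr
        exact hS (δ / 2) (by linarith) n
    _ = _ := by
        rw [show (δ / 2)⁻¹ = 2 * δ⁻¹ by field_simp, Real.mul_rpow (by norm_num) (by positivity)]
        ring

lemma w_lower (a : ℕ → ℕ) (r y D₁ : ℝ) (hr : 0 < r) (hy : 1 ≤ y) (hD : 0 < D₁)
    (hb : ∀ j : ℕ, 1 ≤ j → D₁ * (j : ℝ) ^ (r - 1) * y ^ j ≤ (a j : ℝ)) (σ : ℝ) (m : ℕ) (hm : 1 ≤ m)
    (hδ : (m : ℝ) * (σ - Real.log y) ≤ 1) (j : ℕ) (hj : j ∈ Finset.Ioc m (2 * m)) :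
    D₁ * Real.exp (-2) / 2 * ((m : ℝ) ^ r / m) ≤ (a j : ℝ) * Real.exp (-(j * σ)) := by
  obtain ⟨h1, h2⟩ := Finset.mem_Ioc.1 hj
  have hm' : (1:ℝ) ≤ m := by exact_mod_cast hm
  have h1' : (m:ℝ) ≤ j := by exact_mod_cast h1.le
  have h2' : (j:ℝ) ≤ 2 * m := by exact_mod_cast h2
  have hj0 : (0:ℝ) < j := by linarith
  set δ := σ - Real.log y with hδd
  have hjd : (j : ℝ) * δ ≤ 2 := by
    rcases le_total 0 δ with h | h
    · nlinarith
    · nlinarith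
  have hr1 : (m : ℝ) ^ r / (2 * m) ≤ (j : ℝ) ^ (r - 1) := by
    rw [Real.rpow_sub hj0, Real.rpow_one]
    gcongr
  calc _ = D₁ * ((m : ℝ) ^ r / (2 * m)) * Real.exp (-2) := by field_simp
    _ ≤ D₁ * (j : ℝ) ^ (r - 1) * Real.exp (-(j * δ)) := by gcongr
    _ = D₁ * (j : ℝ) ^ (r - 1) * y ^ j * Real.exp (-(j * σ)) := by
        rw [hδd, ← exp_w y σ hy]; ring
    _ ≤ _ := by gcongr; exact hb j (by omega)

lemma exp3 (u : ℝ) : ‖Complex.exp (Complex.I * u) - 1 - Complex.I * u + (u : ℂ) ^ 2 / 2‖ ≤ 3 * |u| ^ 3 := by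
  have hI : ‖Complex.I * (u : ℂ)‖ = |u| := by simp
  rcases le_total |u| 1 with h | h
  · have := Complex.exp_bound (x := Complex.I * u) (by rw [hI]; exact h) (n := 3) (by norm_num)
    rw [hI] at this
    simp only [Finset.sum_range_succ, Finset.sum_range_zero] at this
    have e : Complex.exp (Complex.I * u) - 1 - Complex.I * u + (u : ℂ) ^ 2 / 2 =
       Complex.exp (Complex.I * u) - (0 + (Complex.I * u) ^ 0 / (Nat.factorial 0 : ℂ) + (Complex.I * u) ^ 1 / (Nat.factorial 1 : ℂ) + (Complex.I * u) ^ 2 / (Nat.factorial 2 : ℂ)) := by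
      simp [Nat.factorial, mul_pow]; ring
    rw [e]
    refine this.trans ?_
    have h0 : 0 ≤ |u| ^ 3 := by positivity
    norm_num [Nat.factorial]
    linarith
  · have h1 := Real.norm_exp_I_mul_ofReal_sub_one_le (x := u)
    have h2 : ‖(u : ℂ) ^ 2 / 2‖ = |u| ^ 2 / 2 := by simp
    have h3 : ‖Complex.exp (Complex.I * u) - 1 - Complex.I * u + (u : ℂ) ^ 2 / 2‖ ≤ |u| + |u| + |u| ^ 2 / 2 := by
      refine (norm_add_le _ _).trans (add_le_add ((norm_sub_le _ _).trans (add_le_add h1 hI.le)) h2.le)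
    refine h3.trans ?_
    have : |u| ≤ |u| ^ 3 := le_self_pow₀ h (by norm_num)
    have : |u| ^ 2 ≤ |u| ^ 3 := pow_le_pow_right₀ h (by norm_num)
    linarith

lemma exp2 (u : ℝ) : ‖Complex.exp (Complex.I * u) - 1 - Complex.I * u‖ ≤ 4 * |u| ^ 2 := by
  have hI : ‖Complex.I * (u : ℂ)‖ = |u| := by simp
  rcases le_total |u| 1 with h | h
  · have h2 : ‖(u : ℂ) ^ 2 / 2‖ = |u| ^ 2 / 2 := by simp
    have h3 := exp3 u
    have : |u| ^ 3 ≤ |u| ^ 2 := pow_le_pow_of_le_one (abs_nonneg u) h (by norm_num)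
    have h4 := norm_sub_le (Complex.exp (Complex.I * u) - 1 - Complex.I * u + (u : ℂ) ^ 2 / 2) ((u : ℂ) ^ 2 / 2)
    rw [add_sub_cancel_right, h2] at h4
    have : 0 ≤ |u| ^ 2 := by positivity
    linarith
  · have h1 := Real.norm_exp_I_mul_ofReal_sub_one_le (x := u)
    have h3 : ‖Complex.exp (Complex.I * u) - 1 - Complex.I * u‖ ≤ |u| + |u| :=
      (norm_sub_le _ _).trans (add_le_add h1 hI.le)
    have : |u| ≤ |u| ^ 2 := le_self_pow₀ h (by norm_num)
    linarith

lemma log_bound (p u : ℝ) (hp : 0 ≤ p) (hpu : p * |u| ≤ 1 / 2) :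
    ‖-Complex.log (1 - p * (Complex.exp (Complex.I * u) - 1)) -
      (Complex.I * p * u - p * (1 + p) * u ^ 2 / 2)‖ ≤ 4 * (p * (1 + p) ^ 2 * |u| ^ 3) := by
  set e := Complex.exp (Complex.I * u) with he
  have h1 : ‖e - 1‖ ≤ |u| := Real.norm_exp_I_mul_ofReal_sub_one_le (x := u)
  have hpn : ‖(p : ℂ)‖ = p := by simp [abs_of_nonneg hp]
  have hw : ‖-((p : ℂ) * (e - 1))‖ ≤ p * |u| := by
    rw [norm_neg, norm_mul, hpn]; gcongr
  have hw1 : ‖-((p : ℂ) * (e - 1))‖ < 1 := by linarith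
  have hL := Complex.norm_log_sub_logTaylor_le 2 hw1
  simp only [Complex.logTaylor_succ, Complex.logTaylor_zero] at hL
  set w := -((p : ℂ) * (e - 1)) with hwd
  have hA : ‖w‖ ^ (2 + 1) * (1 - ‖w‖)⁻¹ / ((2:ℕ) + 1) ≤ p ^ 3 * |u| ^ 3 := by
    have a1 : (1 - ‖w‖)⁻¹ ≤ 2 := by
      rw [show (2:ℝ) = (1/2)⁻¹ by norm_num]
      apply inv_anti₀ (by norm_num); linarith
    have a2 : ‖w‖ ^ 3 ≤ (p * |u|) ^ 3 := by gcongr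
    have a3 : 0 ≤ ‖w‖ ^ 3 := by positivity
    have a4 : ‖w‖ ^ 3 * (1 - ‖w‖)⁻¹ ≤ ‖w‖ ^ 3 * 2 := by gcongr
    rw [mul_pow] at a2
    norm_num
    have : 0 ≤ p ^ 3 * |u| ^ 3 := by positivity
    linarith
  have key : -Complex.log (1 - p * (e - 1)) - (Complex.I * p * u - p * (1 + p) * u ^ 2 / 2)
     = -(Complex.log (1 + w) - (w - w ^ 2 / 2)) + p * (e - 1 - Complex.I * u + (u : ℂ) ^ 2 / 2)
       + p ^ 2 / 2 * ((e - 1 - Complex.I * u) * ((e - 1) + Complex.I * u)) := by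
    have : (1 : ℂ) - p * (e - 1) = 1 + w := by rw [hwd]; ring
    rw [this, hwd]
    ring_nf
    simp only [Complex.I_sq]
    ring
  have hL' : ‖-(Complex.log (1 + w) - (w - w ^ 2 / 2))‖ ≤ p ^ 3 * |u| ^ 3 := by
    rw [norm_neg]
    refine le_trans (le_of_eq ?_) (hL.trans hA)
    congr 1
    norm_num
    ring
  have h3 : ‖(p : ℂ) * (e - 1 - Complex.I * u + (u : ℂ) ^ 2 / 2)‖ ≤ p * (3 * |u| ^ 3) := by
    rw [norm_mul, hpn]; gcongr; exact exp3 u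
  have h4 : ‖(p : ℂ) ^ 2 / 2 * ((e - 1 - Complex.I * u) * ((e - 1) + Complex.I * u))‖
      ≤ p ^ 2 / 2 * ((4 * |u| ^ 2) * (|u| + |u|)) := by
    rw [norm_mul, norm_mul, norm_div, norm_pow, hpn]
    have : ‖Complex.I * (u : ℂ)‖ = |u| := by simp
    have h5 : ‖(e - 1) + Complex.I * u‖ ≤ |u| + |u| := (norm_add_le _ _).trans (add_le_add h1 this.le)
    have h6 := exp2 u
    rw [← he] at h6
    rw [show ‖(2:ℂ)‖ = 2 by norm_num]
    gcongr
  rw [key]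
  refine (norm_add₃_le).trans ((add_le_add (add_le_add hL' h3) h4).trans ?_)
  have hu : 0 ≤ |u| ^ 3 := by positivity
  have : p ^ 3 * |u| ^ 3 + p * (3 * |u| ^ 3) + p ^ 2 / 2 * ((4 * |u| ^ 2) * (|u| + |u|))
    = (p ^ 3 + 3 * p + 4 * p ^ 2) * |u| ^ 3 := by ring
  rw [this, ← mul_assoc]
  gcongr
  nlinarith [pow_nonneg hp 2, pow_nonneg hp 3]

lemma fac_eq (q u : ℝ) (hq : 0 < q) (hq1 : q < 1) (hpu : q / (1 - q) * |u| ≤ 1 / 2) :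
    (((1 - q : ℝ) : ℂ) / (1 - (q : ℂ) * Complex.exp (Complex.I * u))) =
      Complex.exp (-Complex.log (1 - ((q / (1 - q) : ℝ) : ℂ) * (Complex.exp (Complex.I * u) - 1))) := by
  have h1q : (1 : ℂ) - q ≠ 0 := by
    rw [← Complex.ofReal_one, ← Complex.ofReal_sub]; exact_mod_cast (by linarith : (1 - q) ≠ 0)
  have hp : 0 ≤ q / (1 - q) := div_nonneg hq.le (by linarith)
  have hne : 1 - ((q / (1 - q) : ℝ) : ℂ) * (Complex.exp (Complex.I * u) - 1) ≠ 0 := by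
    intro h
    have h1 : ‖((q / (1 - q) : ℝ) : ℂ) * (Complex.exp (Complex.I * u) - 1)‖ = 1 := by
      rw [← sub_eq_zero.1 h]; simp
    rw [norm_mul, Complex.norm_real, Real.norm_of_nonneg hp] at h1
    have h2 : ‖Complex.exp (Complex.I * u) - 1‖ ≤ |u| := Real.norm_exp_I_mul_ofReal_sub_one_le (x := u)
    have := mul_le_mul_of_nonneg_left h2 hp
    linarith
  rw [Complex.exp_neg, Complex.exp_log hne, ← inv_div]
  congr 1
  push_cast
  field_simp
  ring

lemma fac_norm (q u : ℝ) (hq : 0 < q) (hq1 : q < 1) :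
    ‖(((1 - q : ℝ) : ℂ) / (1 - (q : ℂ) * Complex.exp (Complex.I * u)))‖ ≤
      Real.exp (-(2 / 5 * (q * Real.sin (u / 2) ^ 2))) := by
  set s := Real.sin (u / 2) ^ 2 with hs
  have hs0 : 0 ≤ s := by positivity
  have hs1 : s ≤ 1 := Real.sin_sq_le_one _
  have hn : ‖(1 - (q : ℂ) * Complex.exp (Complex.I * u))‖ ^ 2 = (1 - q) ^ 2 + 4 * q * s := by
    rw [← Complex.normSq_eq_norm_sq, mul_comm Complex.I, Complex.exp_mul_I, Complex.normSq_apply]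
    have hc : Real.cos u = 1 - 2 * s := by
      have := Real.cos_sq' (u / 2)
      have h2 := Real.cos_two_mul (u / 2)
      rw [show 2 * (u / 2) = u by ring] at h2
      rw [h2, this, hs]; ring
    have hsc := Real.sin_sq_add_cos_sq u
    simp [← Complex.ofReal_cos, ← Complex.ofReal_sin]
    rw [hc] at hsc ⊢
    nlinarith
  have h1q : 0 < 1 - q := by linarith
  have hpos : 0 < (1 - q) ^ 2 + 4 * q * s := by positivity
  rw [← abs_of_nonneg (norm_nonneg (_ / _)), ← abs_of_pos (Real.exp_pos (-(2 / 5 * (q * s)))), ← sq_le_sq,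
    norm_div, div_pow, hn, ← Real.exp_nat_mul, Complex.norm_real, Real.norm_of_nonneg h1q.le]
  have hx : (1 - q) ^ 2 / ((1 - q) ^ 2 + 4 * q * s) ≤ 1 / (1 + 4 * q * s) := by
    rw [div_le_div_iff₀ hpos (by positivity)]
    have h3 : (1 - q) ^ 2 ≤ 1 := by nlinarith
    have : 0 ≤ 4 * q * s := by positivity
    nlinarith
  refine hx.trans ?_
  have hy : 1 / (1 + 4 * q * s) ≤ 1 + (-(4 / 5 * (q * s))) := by
    rw [div_le_iff₀ (by positivity)]
    have : 0 ≤ q * s := by positivity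
    have : q * s ≤ 1 := by nlinarith
    nlinarith
  refine hy.trans ?_
  have := Real.add_one_le_exp (-(4 / 5 * (q * s)))
  refine le_trans (by linarith) (this.trans (Real.exp_le_exp.2 ?_))
  push_cast; linarith

lemma q_bounds (σ : ℝ) (hσ : 0 < σ) (j : ℕ) (hj : 1 ≤ j) :
    0 < Real.exp (-(j * σ)) ∧ Real.exp (-(j * σ)) < 1 := by
  refine ⟨Real.exp_pos _, ?_⟩
  rw [Real.exp_lt_one_iff]
  have hj' : (1 : ℝ) ≤ j := by exact_mod_cast hj
  have : 0 < (j:ℝ) * σ := mul_pos (by linarith) hσ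
  linarith

lemma phi_norm (a : ℕ → ℕ) (n : ℕ) (σ α : ℝ) (hσ : 0 < σ) :
    ‖phi a n σ α‖ ≤ Real.exp (-(2 / 5 * ∑ j ∈ Finset.Icc 1 n,
      (a j : ℝ) * Real.exp (-(j * σ)) * Real.sin (Real.pi * j * α) ^ 2)) := by
  unfold phi
  rw [norm_prod, Finset.mul_sum, ← Finset.sum_neg_distrib, Real.exp_sum]
  refine Finset.prod_le_prod (fun _ _ => norm_nonneg _) fun j hj => ?_
  obtain ⟨h0, h1⟩ := q_bounds σ hσ j (Finset.mem_Icc.1 hj).1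
  have := fac_norm (Real.exp (-(j * σ))) (2 * Real.pi * α * j) h0 h1
  rw [norm_pow]
  have e1 : Complex.exp (2 * Real.pi * Complex.I * α * j) = Complex.exp (Complex.I * ((2 * Real.pi * α * j : ℝ) : ℂ)) := by
    congr 1; push_cast; ring
  rw [e1]
  refine (pow_le_pow_left₀ (norm_nonneg _) this _).trans (le_of_eq ?_)
  rw [← Real.exp_nat_mul]
  congr 1
  rw [show 2 * Real.pi * α * j / 2 = Real.pi * j * α by ring]
  ring

lemma sin_sum_small (m : ℕ) (α : ℝ) (h : 2 * m * |α| ≤ 1 / 2) :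
    4 * (m : ℝ) ^ 2 * α ^ 2 * m ≤ ∑ j ∈ Finset.Ioc m (2 * m), Real.sin (Real.pi * j * α) ^ 2 := by
  have : ∑ j ∈ Finset.Ioc m (2 * m), 4 * (m : ℝ) ^ 2 * α ^ 2 = 4 * (m : ℝ) ^ 2 * α ^ 2 * m := by
    rw [Finset.sum_const, Nat.card_Ioc, nsmul_eq_mul, show 2 * m - m = m by omega]; ring
  rw [← this]
  refine Finset.sum_le_sum fun j hj => ?_
  obtain ⟨h1, h2⟩ := Finset.mem_Ioc.1 hj
  have h1' : (m:ℝ) ≤ j := by exact_mod_cast h1.le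
  have h2' : (j:ℝ) ≤ 2 * m := by exact_mod_cast h2
  have hx : Real.sin (Real.pi * j * α) ^ 2 = Real.sin (Real.pi * j * |α|) ^ 2 := by
    rcases abs_choice α with h | h <;> rw [h]
    rw [mul_neg, Real.sin_neg, neg_sq]
  have ha := abs_nonneg α
  have hjα : (j : ℝ) * |α| ≤ 1 / 2 := le_trans (by gcongr) h
  have hp := Real.pi_pos
  have hs := Real.mul_le_sin (x := Real.pi * j * |α|) (by positivity) (by nlinarith)
  have e : 2 / Real.pi * (Real.pi * j * |α|) = 2 * j * |α| := by field_simp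
  rw [e] at hs
  rw [hx, ← sq_abs α]
  calc 4 * (m : ℝ) ^ 2 * |α| ^ 2 = (2 * m * |α|) ^ 2 := by ring
    _ ≤ (2 * j * |α|) ^ 2 := by gcongr
    _ ≤ _ := by gcongr

lemma cos_tele (x : ℝ) (m k : ℕ) :
    Real.sin x * ∑ j ∈ Finset.Ioc m (m + k), 2 * Real.cos (2 * j * x)
      = Real.sin ((2 * (m + k) + 1) * x) - Real.sin ((2 * m + 1) * x) := by
  induction k with
  | zero => simp
  | succ k ih =>
    rw [← add_assoc, Finset.sum_Ioc_succ_top (by omega), mul_add, ih]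
    have : Real.sin x * (2 * Real.cos (2 * ((m + k + 1 : ℕ) : ℝ) * x)) =
        Real.sin (2 * (m + k + 1) * x + x) - Real.sin (2 * (m + k + 1) * x - x) := by
      rw [Real.sin_add, Real.sin_sub]; push_cast; ring
    rw [this]
    push_cast
    rw [show 2 * ((m:ℝ) + k + 1) * x - x = (2 * (m + k) + 1) * x by ring,
     show 2 * ((m:ℝ) + k + 1) * x + x = (2 * (m + (k + 1)) + 1) * x by ring]
    ring

lemma sin_sum_large (m : ℕ) (α : ℝ) (h : 1 ≤ m * |α|) (h2 : |α| ≤ 1 / 2) :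
    (1 / 4 : ℝ) * m ≤ ∑ j ∈ Finset.Ioc m (2 * m), Real.sin (Real.pi * j * α) ^ 2 := by
  have hx : ∀ j : ℕ, Real.sin (Real.pi * j * α) ^ 2 = 1 / 2 - 2 * Real.cos (2 * j * (Real.pi * |α|)) / 4 := by
    intro j
    have : Real.sin (Real.pi * j * α) ^ 2 = Real.sin (j * (Real.pi * |α|)) ^ 2 := by
      rcases abs_choice α with h | h <;> rw [h]
      · ring_nf
      · rw [show (j:ℝ) * (Real.pi * -α) = -(Real.pi * j * α) by ring, Real.sin_neg, neg_sq]
    rw [this, Real.sin_sq_eq_half_sub, ← mul_assoc 2]; ring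
  simp_rw [hx]
  rw [Finset.sum_sub_distrib, ← Finset.sum_div (Finset.Ioc m (2 * m)) (fun j : ℕ => 2 * Real.cos (2 * j * (Real.pi * |α|))), Finset.sum_const, Nat.card_Ioc, nsmul_eq_mul,
    show 2 * m - m = m by omega]
  have ht := cos_tele (Real.pi * |α|) m m
  rw [show m + m = 2 * m by ring] at ht
  set S := ∑ j ∈ Finset.Ioc m (2 * m), 2 * Real.cos (2 * j * (Real.pi * |α|))
  have hp := Real.pi_pos
  have ha := abs_nonneg α
  have hs := Real.mul_le_sin (x := Real.pi * |α|) (by positivity) (by nlinarith)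
  have e : 2 / Real.pi * (Real.pi * |α|) = 2 * |α| := by field_simp
  rw [e] at hs
  have hb : Real.sin (Real.pi * |α|) * S ≤ 2 := by
    rw [ht]
    linarith [Real.sin_le_one ((2 * ((m:ℝ) + m) + 1) * (Real.pi * |α|)), Real.neg_one_le_sin ((2 * (m:ℝ) + 1) * (Real.pi * |α|))]
  have hm : (0:ℝ) ≤ m := by positivity
  have hS : S ≤ m := by
    by_contra hc
    push Not at hc
    have : 2 * |α| * S ≤ 2 := le_trans (by gcongr; linarith) hb
    have hα : 0 < |α| := by
      rcases ha.eq_or_lt with h0 | h0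
      · rw [← h0] at h; norm_num at h
      · exact h0
    nlinarith
  linarith

lemma Tk_lower (a : ℕ → ℕ) (r y D₁ : ℝ) (hr : 0 < r) (hy : 1 ≤ y) (hD : 0 < D₁)
    (hb : ∀ j : ℕ, 1 ≤ j → D₁ * (j : ℝ) ^ (r - 1) * y ^ j ≤ (a j : ℝ)) (σ : ℝ) (hσ : 0 < σ)
    (m n k : ℕ) (hm : 1 ≤ m) (hmn : 2 * m ≤ n)
    (hδ : (m : ℝ) * (σ - Real.log y) ≤ 1) :
    D₁ * Real.exp (-2) / 2 * ((m : ℝ) ^ r * (m : ℝ) ^ k) ≤ Tk a n σ k := by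
  have hm' : (1:ℝ) ≤ m := by exact_mod_cast hm
  have hsub : Finset.Ioc m (2 * m) ⊆ Finset.Icc 1 n := by
    intro j hj; simp only [Finset.mem_Ioc, Finset.mem_Icc] at *; omega
  have hd : ∀ j ∈ Finset.Icc 1 n, (j : ℝ) ≤ (j : ℝ) / (1 - Real.exp (-(j * σ))) := by
    intro j hj
    obtain ⟨h0, h1⟩ := q_bounds σ hσ j (Finset.mem_Icc.1 hj).1
    rw [le_div_iff₀ (by linarith)]
    have : (0:ℝ) ≤ j := by positivity
    nlinarith
  have h2 : ∑ j ∈ Finset.Ioc m (2 * m), D₁ * Real.exp (-2) / 2 * ((m : ℝ) ^ r / m) * (m : ℝ) ^ k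
      = D₁ * Real.exp (-2) / 2 * ((m : ℝ) ^ r * (m : ℝ) ^ k) := by
    rw [Finset.sum_const, Nat.card_Ioc, nsmul_eq_mul, show 2 * m - m = m by omega]
    field_simp
  rw [← h2]
  unfold Tk
  refine le_trans (Finset.sum_le_sum fun j hj => ?_) (Finset.sum_le_sum_of_subset_of_nonneg hsub ?_)
  · have h1 := w_lower a r y D₁ hr hy hD hb σ m hm hδ j hj
    have hmj : (m:ℝ) ≤ j := by exact_mod_cast (Finset.mem_Ioc.1 hj).1.le
    have := hd j (hsub hj)
    have h3 : (m:ℝ) ^ k ≤ ((j : ℝ) / (1 - Real.exp (-(j * σ)))) ^ k :=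
      pow_le_pow_left₀ (by linarith) (by linarith) k
    gcongr
  · intro j hj _
    have : (0:ℝ) ≤ (j : ℝ) / (1 - Real.exp (-(j * σ))) := le_trans (by positivity) (hd j hj)
    positivity

lemma params (a : ℕ → ℕ) (r y D₁ D₂ : ℝ) (hr : 0 < r) (hy : 1 ≤ y) (hD₁ : 0 < D₁) (hD₂ : 0 < D₂)
    (hb : ∀ j : ℕ, 1 ≤ j → D₁ * (j : ℝ) ^ (r - 1) * y ^ j ≤ (a j : ℝ))
    (hb2 : ∀ j : ℕ, 1 ≤ j → (a j : ℝ) ≤ D₂ * (j : ℝ) ^ (r - 1) * y ^ j)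
    (σ : ℕ → ℝ) (hσ : ∀ n : ℕ, 1 ≤ n → 0 < σ n ∧ Mfun a n (σ n) = n) :
    ∃ C c : ℝ, 0 < C ∧ 0 < c ∧ Tendsto (fun n => (σ n - Real.log y)⁻¹) atTop atTop ∧
      ∀ᶠ n : ℕ in atTop, 1 ≤ n ∧ 8 ≤ (σ n - Real.log y)⁻¹ ∧ 2 * (σ n - Real.log y)⁻¹ ≤ n ∧
        c * ((σ n - Real.log y)⁻¹ ^ r * (σ n - Real.log y)⁻¹ ^ 2) ≤ Tk a n (σ n) 2 ∧
        Tk a n (σ n) 2 ≤ C * ((σ n - Real.log y)⁻¹ ^ r * (σ n - Real.log y)⁻¹ ^ 2) ∧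
        Tk a n (σ n) 3 ≤ C * ((σ n - Real.log y)⁻¹ ^ r * (σ n - Real.log y)⁻¹ ^ 3) := by
  obtain ⟨C1, hC1, h1⟩ := T_bound a r y D₂ hr hy hD₂ hb2 1 le_rfl
  obtain ⟨C2, hC2, h2⟩ := T_bound a r y D₂ hr hy hD₂ hb2 2 (by norm_num)
  obtain ⟨C3, hC3, h3⟩ := T_bound a r y D₂ hr hy hD₂ hb2 3 (by norm_num)
  set c1 := D₁ * Real.exp (-2) / 2 with hc1
  have hc1p : 0 < c1 := by positivity
  have E1 : ∀ᶠ n : ℕ in atTop, 1 ≤ n ∧ 2 < n * (σ n - Real.log y) := by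
    have ht : Tendsto (fun n : ℕ => c1 * ((n / 2 : ℕ) : ℝ) ^ r) atTop atTop := by
      refine Tendsto.const_mul_atTop hc1p ?_
      refine (tendsto_rpow_atTop hr).comp (tendsto_natCast_atTop_atTop.comp ?_)
      exact Nat.tendsto_div_const_atTop (by norm_num)
    filter_upwards [ht.eventually_gt_atTop 3, eventually_ge_atTop 2] with n hn hn2
    refine ⟨by omega, ?_⟩
    by_contra hc
    push Not at hc
    obtain ⟨hs, hM⟩ := hσ n (by omega)
    set m := n / 2 with hm
    have hm1 : 1 ≤ m := by omega
    have hm2 : 2 * m ≤ n := by omega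
    have hm3 : n ≤ 3 * m := by omega
    have hm2' : 2 * (m:ℝ) ≤ n := by exact_mod_cast hm2
    have hm3' : (n:ℝ) ≤ 3 * m := by exact_mod_cast hm3
    have hm1' : (1:ℝ) ≤ m := by exact_mod_cast hm1
    have hmδ : (m : ℝ) * (σ n - Real.log y) ≤ 1 := by
      rcases le_total 0 (σ n - Real.log y) with h | h
      · nlinarith
      · nlinarith
    have := Tk_lower a r y D₁ hr hy hD₁ hb (σ n) hs m n 1 hm1 hm2 hmδ
    rw [← Mfun_eq, hM, pow_one, ← mul_assoc, ← hc1] at this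
    have h9 := mul_lt_mul_of_pos_right hn (by linarith : (0:ℝ) < m)
    linarith
  have hpos : ∀ n : ℕ, 1 ≤ n → 2 < n * (σ n - Real.log y) → 0 < σ n - Real.log y := by
    intro n hn h
    have hn' : (1:ℝ) ≤ n := by exact_mod_cast hn
    by_contra hc
    push Not at hc
    nlinarith
  have hT : Tendsto (fun n => (σ n - Real.log y)⁻¹) atTop atTop := by
    rw [tendsto_atTop]
    intro A
    filter_upwards [E1, eventually_gt_atTop (⌈C1 * ((max A 1) ^ r * (max A 1) ^ 1)⌉₊)] with n hn hn2
    by_contra hc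
    push Not at hc
    have hδ := hpos n hn.1 hn.2
    have := h1 n (σ n) hδ
    rw [← Mfun_eq, (hσ n hn.1).2] at this
    have h4 : (σ n - Real.log y)⁻¹ ≤ max A 1 := hc.le.trans (le_max_left _ _)
    have h5 : C1 * ((σ n - Real.log y)⁻¹ ^ r * (σ n - Real.log y)⁻¹ ^ 1) ≤ C1 * ((max A 1) ^ r * (max A 1) ^ 1) := by
      gcongr
    have h6 := Nat.lt_of_ceil_lt hn2
    linarith
  refine ⟨max C2 C3, c1 * ((1 / 2) ^ r * (1 / 2) ^ 2), by positivity, by positivity, hT, ?_⟩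
  filter_upwards [E1, hT.eventually_ge_atTop 8] with n hn h8
  have hδ := hpos n hn.1 hn.2
  obtain ⟨hs, hM⟩ := hσ n hn.1
  set s := (σ n - Real.log y)⁻¹ with hsd
  have hs0 : 0 < s := by linarith
  have hδs : σ n - Real.log y = s⁻¹ := by rw [hsd, inv_inv]
  have h2s : 2 * s ≤ n := by
    have := hn.2
    rw [hδs, ← div_eq_mul_inv, lt_div_iff₀ hs0] at this
    exact this.le
  refine ⟨hn.1, h8, h2s, ?_, ?_, ?_⟩
  · set m := ⌊s⌋₊ with hm
    have hm1 : (m:ℝ) ≤ s := Nat.floor_le hs0.le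
    have hm2 : s < m + 1 := Nat.lt_floor_add_one s
    have hm3 : s * (1 / 2) ≤ m := by linarith
    have hm4 : 1 ≤ m := by
      have : (0:ℝ) < m := by linarith
      exact_mod_cast this
    have hm5 : 2 * m ≤ n := by
      have : (2:ℝ) * m ≤ n := by linarith
      exact_mod_cast this
    have := Tk_lower a r y D₁ hr hy hD₁ hb (σ n) hs m n 2 hm4 hm5
      (by rw [hδs, ← div_eq_mul_inv, div_le_one hs0]; exact hm1)
    refine le_trans ?_ this
    calc c1 * ((1 / 2) ^ r * (1 / 2) ^ 2) * (s ^ r * s ^ 2) = c1 * ((s * (1 / 2)) ^ r * (s * (1 / 2)) ^ 2) := by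
          rw [Real.mul_rpow hs0.le (by norm_num)]; ring
      _ ≤ _ := by gcongr
  · refine (h2 n (σ n) hδ).trans ?_
    gcongr; exact le_max_left _ _
  · refine (h3 n (σ n) hδ).trans ?_
    gcongr; exact le_max_right _ _

lemma phi_window (a : ℕ → ℕ) (r y D₁ : ℝ) (hr : 0 < r) (hy : 1 ≤ y) (hD : 0 < D₁)
    (hb : ∀ j : ℕ, 1 ≤ j → D₁ * (j : ℝ) ^ (r - 1) * y ^ j ≤ (a j : ℝ)) (σ : ℝ) (hσ : 0 < σ)
    (m n : ℕ) (hm : 1 ≤ m) (hmn : 2 * m ≤ n)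
    (hδ : (m : ℝ) * (σ - Real.log y) ≤ 1) (α : ℝ) :
    ‖phi a n σ α‖ ≤ Real.exp (-(2 / 5 * (D₁ * Real.exp (-2) / 2 * ((m : ℝ) ^ r / m) *
      ∑ j ∈ Finset.Ioc m (2 * m), Real.sin (Real.pi * j * α) ^ 2))) := by
  refine (phi_norm a n σ α hσ).trans (Real.exp_le_exp.2 (neg_le_neg ?_))
  refine mul_le_mul_of_nonneg_left ?_ (by norm_num)
  have hsub : Finset.Ioc m (2 * m) ⊆ Finset.Icc 1 n := by
    intro j hj; simp only [Finset.mem_Ioc, Finset.mem_Icc] at *; omega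
  rw [Finset.mul_sum]
  refine le_trans (Finset.sum_le_sum fun j hj => ?_) (Finset.sum_le_sum_of_subset_of_nonneg hsub ?_)
  · exact mul_le_mul_of_nonneg_right (w_lower a r y D₁ hr hy hD hb σ m hm hδ j hj) (by positivity)
  · intro j _ _; positivity

lemma phi_decay (a : ℕ → ℕ) (r y D₁ : ℝ) (hr : 0 < r) (hy : 1 ≤ y) (hD : 0 < D₁)
    (hb : ∀ j : ℕ, 1 ≤ j → D₁ * (j : ℝ) ^ (r - 1) * y ^ j ≤ (a j : ℝ)) :
    ∃ c : ℝ, 0 < c ∧ ∀ (σ : ℝ) (n : ℕ) (s : ℝ), 0 < σ → σ - Real.log y = s⁻¹ → 8 ≤ s → 2 * s ≤ n →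
      ∀ α : ℝ, |α| ≤ 1 / 2 →
      ‖phi a n σ α‖ ≤ Real.exp (-(c * (s ^ r * (s ^ 2 * α ^ 2)))) ∨
        ‖phi a n σ α‖ ≤ Real.exp (-(c * s ^ r)) := by
  refine ⟨D₁ * Real.exp (-2) / 2 * (1 / 16) ^ r / 160, by positivity, ?_⟩
  intro σ n s hσ hδs h8 hsn α hα
  set c1 := D₁ * Real.exp (-2) / 2 with hc1
  have hc1p : 0 < c1 := by positivity
  have hs0 : 0 < s := by linarith
  rcases le_total (s * |α|) 2 with h | h
  · left
    set m := ⌊s / 8⌋₊ with hm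
    have hm1 : (m:ℝ) ≤ s / 8 := Nat.floor_le (by positivity)
    have hm2 : s / 8 < m + 1 := Nat.lt_floor_add_one _
    have hm4 : 1 ≤ m := Nat.one_le_floor_iff _ |>.2 (by linarith)
    have hm4' : (1:ℝ) ≤ m := by exact_mod_cast hm4
    have hm3 : s * (1 / 16) ≤ m := by linarith
    have hm5 : 2 * m ≤ n := by
      have : (2:ℝ) * m ≤ n := by linarith
      exact_mod_cast this
    refine (phi_window a r y D₁ hr hy hD hb σ hσ m n hm4 hm5
      (by rw [hδs, ← div_eq_mul_inv, div_le_one hs0]; linarith) α).trans ?_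
    refine Real.exp_le_exp.2 (neg_le_neg ?_)
    have h1 := sin_sum_small m α (by
      have := mul_le_mul_of_nonneg_right hm1 (abs_nonneg α)
      linarith)
    calc c1 * (1 / 16) ^ r / 160 * (s ^ r * (s ^ 2 * α ^ 2))
        = 2 / 5 * (c1 * ((s * (1 / 16)) ^ r) * (4 * (s * (1 / 16)) ^ 2 * α ^ 2)) := by
          rw [Real.mul_rpow hs0.le (by norm_num)]; ring
      _ ≤ 2 / 5 * (c1 * ((m:ℝ) ^ r) * (4 * (m:ℝ) ^ 2 * α ^ 2)) := by gcongr
      _ = 2 / 5 * (c1 * ((m:ℝ) ^ r / m) * (4 * (m:ℝ) ^ 2 * α ^ 2 * m)) := by field_simp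
      _ ≤ _ := by gcongr
  · right
    set m := ⌊s⌋₊ with hm
    have hm1 : (m:ℝ) ≤ s := Nat.floor_le (by positivity)
    have hm2 : s < m + 1 := Nat.lt_floor_add_one _
    have hm4 : 1 ≤ m := Nat.one_le_floor_iff _ |>.2 (by linarith)
    have hm4' : (1:ℝ) ≤ m := by exact_mod_cast hm4
    have hm3 : s * (1 / 16) ≤ m := by linarith
    have hm5 : 2 * m ≤ n := by
      have : (2:ℝ) * m ≤ n := by linarith
      exact_mod_cast this
    refine (phi_window a r y D₁ hr hy hD hb σ hσ m n hm4 hm5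
      (by rw [hδs, ← div_eq_mul_inv, div_le_one hs0]; linarith) α).trans ?_
    refine Real.exp_le_exp.2 (neg_le_neg ?_)
    have h1 := sin_sum_large m α (by
      have : s / 2 ≤ m := by linarith
      have := mul_le_mul_of_nonneg_right this (abs_nonneg α)
      linarith) hα
    calc c1 * (1 / 16) ^ r / 160 * s ^ r
        = 1 / 160 * (c1 * ((s * (1 / 16)) ^ r)) := by
          rw [Real.mul_rpow hs0.le (by norm_num)]; ring
      _ ≤ 1 / 10 * (c1 * ((m:ℝ) ^ r)) := by gcongr; norm_num
      _ = 2 / 5 * (c1 * ((m:ℝ) ^ r / m) * (1 / 4 * m)) := by field_simp; norm_num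
      _ ≤ _ := by gcongr

lemma phi_exp (a : ℕ → ℕ) (n : ℕ) (σ α θ : ℝ) (hσ : 0 < σ) (hθ : 2 * Real.pi * α = θ)
    (hsm : ∀ j ∈ Finset.Icc 1 n, Real.exp (-(j * σ)) / (1 - Real.exp (-(j * σ))) * |j * θ| ≤ 1 / 2) :
    ∃ E : ℂ, phi a n σ α = Complex.exp E ∧
      ‖E - (Complex.I * θ * (Tk a n σ 1 : ℝ) - θ ^ 2 * (Tk a n σ 2 : ℝ) / 2)‖ ≤ 4 * (|θ| ^ 3 * Tk a n σ 3) := by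
  set q : ℕ → ℝ := fun j => Real.exp (-(j * σ)) with hq
  refine ⟨∑ j ∈ Finset.Icc 1 n, (a j : ℂ) * (-Complex.log (1 - ((q j / (1 - q j) : ℝ) : ℂ) *
    (Complex.exp (Complex.I * ((j * θ : ℝ) : ℂ)) - 1))), ?_, ?_⟩
  · rw [Complex.exp_sum]
    unfold phi
    refine Finset.prod_congr rfl fun j hj => ?_
    obtain ⟨h0, h1⟩ := q_bounds σ hσ j (Finset.mem_Icc.1 hj).1
    rw [Complex.exp_nat_mul, ← fac_eq (q j) (j * θ) h0 h1 (hsm j hj), ← hθ]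
    congr 4
    push_cast; ring
  · unfold Tk
    push_cast
    rw [Finset.mul_sum, Finset.mul_sum, Finset.sum_div, ← Finset.sum_sub_distrib, ← Finset.sum_sub_distrib,
      Finset.mul_sum, Finset.mul_sum]
    refine norm_sum_le_of_le _ fun j hj => ?_
    obtain ⟨h0, h1⟩ := q_bounds σ hσ j (Finset.mem_Icc.1 hj).1
    have hp : 0 ≤ q j / (1 - q j) := div_nonneg h0.le (by linarith)
    have hb := log_bound (q j / (1 - q j)) (j * θ) hp (hsm j hj)
    have h1q : (1 - q j) ≠ 0 := by linarith
    have h1qc : (1 : ℂ) - (q j : ℂ) ≠ 0 := by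
      rw [← Complex.ofReal_one, ← Complex.ofReal_sub]; exact_mod_cast h1q
    have hqe : Complex.exp (-(j * σ)) = (q j : ℂ) := by rw [hq]; push_cast; rfl
    have hqe2 : Real.exp (-(j * σ)) = q j := rfl
    rw [hqe, hqe2]
    have := mul_le_mul_of_nonneg_left hb (Nat.cast_nonneg (a j) : (0:ℝ) ≤ a j)
    have hn : ((a j : ℕ) : ℝ) = ‖((a j : ℕ) : ℂ)‖ := by simp
    rw [hn, ← norm_mul, ← hn] at this
    refine le_trans (le_of_eq ?_) (this.trans (le_of_eq ?_))
    · congr 1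
      push_cast
      rw [mul_sub]
      congr 1
      field_simp
      ring
    · rw [abs_mul, abs_of_nonneg (Nat.cast_nonneg j : (0:ℝ) ≤ j)]
      field_simp
      ring

noncomputable def FF (a : ℕ → ℕ) (n : ℕ) (σ α : ℝ) : ℂ :=
  phi a n σ α * Complex.exp (-(2 * Real.pi * Complex.I * α * n))

lemma FF_periodic (a : ℕ → ℕ) (n : ℕ) (σ : ℝ) : Function.Periodic (FF a n σ) 1 := by
  intro α
  have h1 : ∀ j : ℕ, Complex.exp (2 * Real.pi * Complex.I * ((α + 1 : ℝ) : ℂ) * j)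
      = Complex.exp (2 * Real.pi * Complex.I * α * j) := by
    intro j
    rw [← mul_one (Complex.exp (2 * Real.pi * Complex.I * α * j)), ← Complex.exp_nat_mul_two_pi_mul_I j,
      ← Complex.exp_add]
    congr 1; push_cast; ring
  unfold FF phi
  rw [Complex.exp_neg, Complex.exp_neg]
  simp_rw [h1]

lemma FF_conj (a : ℕ → ℕ) (n : ℕ) (σ α : ℝ) : FF a n σ (-α) = (starRingEnd ℂ) (FF a n σ α) := by
  unfold FF phi
  have h2 : (starRingEnd ℂ) 2 = 2 := Complex.conj_ofNat 2
  simp [map_mul, map_prod, ← Complex.exp_conj, map_div₀, h2]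

lemma FF_meas (a : ℕ → ℕ) (n : ℕ) (σ : ℝ) : Measurable (FF a n σ) := by
  unfold FF phi
  fun_prop

lemma FF_norm (a : ℕ → ℕ) (n : ℕ) (σ α : ℝ) : ‖FF a n σ α‖ = ‖phi a n σ α‖ := by
  unfold FF
  rw [norm_mul, show -(2 * Real.pi * Complex.I * α * n) = ((-(2 * Real.pi * α * n) : ℝ) : ℂ) * Complex.I by
    push_cast; ring, Complex.norm_exp_ofReal_mul_I, mul_one]

lemma int_shift (a : ℕ → ℕ) (n : ℕ) (σ : ℝ) :
    ∫ α in (0:ℝ)..1, FF a n σ α = ∫ α in (-(1/2):ℝ)..(1/2), FF a n σ α := by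
  have := (FF_periodic a n σ).intervalIntegral_add_eq 0 (-(1/2))
  rw [zero_add, show (-(1/2) + 1 : ℝ) = 1/2 by norm_num] at this
  exact this

lemma int_real (a : ℕ → ℕ) (n : ℕ) (σ : ℝ) : (∫ α in (0:ℝ)..1, FF a n σ α).im = 0 := by
  rw [int_shift, ← Complex.conj_eq_iff_im]
  have h1 : ∫ α in (-(1/2):ℝ)..(1/2), FF a n σ (-α) = ∫ α in (-(1/2):ℝ)..(1/2), FF a n σ α := by
    rw [intervalIntegral.integral_comp_neg, neg_neg]
  rw [← h1]
  simp_rw [FF_conj]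
  rw [intervalIntegral.integral_of_le (by norm_num), integral_conj, Complex.conj_conj, ← integral_conj,
    ← intervalIntegral.integral_of_le (by norm_num)]
  simp_rw [← FF_conj]
  rw [← intervalIntegral.integral_of_le (by norm_num)]
  exact h1.symm

lemma int_scale (a : ℕ → ℕ) (n : ℕ) (σ B : ℝ) (hB : 0 < B) :
    ((Real.sqrt (2 * Real.pi * B ^ 2) : ℝ) : ℂ) * ∫ α in (0:ℝ)..1, FF a n σ α =
    ((Real.sqrt (2 * Real.pi) : ℝ) : ℂ)⁻¹ *
      ∫ t : ℝ, (Set.Ioc (-(Real.pi * B)) (Real.pi * B)).indicator (fun t => FF a n σ (t / (2 * Real.pi * B))) t := by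
  have hp := Real.pi_pos
  rw [MeasureTheory.integral_indicator measurableSet_Ioc, ← intervalIntegral.integral_of_le
    (by have : 0 < Real.pi * B := by positivity
        linarith), intervalIntegral.integral_comp_div _ (by positivity), int_shift]
  have e1 : -(Real.pi * B) / (2 * Real.pi * B) = -(1/2) := by field_simp
  have e2 : (Real.pi * B) / (2 * Real.pi * B) = 1/2 := by field_simp
  rw [e1, e2, Complex.real_smul, ← mul_assoc]
  congr 1
  rw [Real.sqrt_mul (by positivity), Real.sqrt_sq hB.le, ← Complex.ofReal_inv, ← Complex.ofReal_mul]
  congr 1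
  have h : Real.sqrt (2 * Real.pi) * Real.sqrt (2 * Real.pi) = 2 * Real.pi := Real.mul_self_sqrt (by positivity)
  have h0 : 0 < Real.sqrt (2 * Real.pi) := by positivity
  rw [eq_inv_mul_iff_mul_eq₀ h0.ne', ← mul_assoc, h]

lemma small_p (σ s : ℝ) (hs : 0 < s) (h : s⁻¹ ≤ σ) (j : ℕ) (hj : 1 ≤ j) :
    Real.exp (-(j * σ)) / (1 - Real.exp (-(j * σ))) * j ≤ s := by
  have hσ : 0 < σ := lt_of_lt_of_le (by positivity) h
  obtain ⟨h0, h1⟩ := q_bounds σ hσ j hj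
  have hj' : (1 : ℝ) ≤ j := by exact_mod_cast hj
  have h2 : Real.exp (-(j * σ)) * (1 + j * σ) ≤ 1 := by
    rw [Real.exp_neg, inv_mul_le_iff₀ (Real.exp_pos _)]
    linarith [Real.add_one_le_exp ((j : ℝ) * σ)]
  rw [div_mul_eq_mul_div, div_le_iff₀ (by linarith)]
  have h3 : 1 ≤ s * σ := by
    rw [inv_le_iff_one_le_mul₀ hs] at h; linarith
  set q := Real.exp (-(j * σ))
  have h5 : q * j * 1 ≤ q * j * (s * σ) := by gcongr
  nlinarith

lemma rpow_exp_aux (r c : ℝ) (hr : 0 < r) (hc : 0 < c) : ∃ K : ℝ, 0 < K ∧ ∀ s : ℝ, 0 < s →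
    (s ^ r * s ^ 2) * Real.exp (-(c * s ^ r)) ≤ K := by
  set k := 1 + 2 / r with hk
  have hk0 : 0 < k := by positivity
  refine ⟨(2 * k) ^ k / (2 * c) ^ k, by positivity, fun s hs => ?_⟩
  have h := rpow_le_exp_half k (2 * c * s ^ r) hk0 (by positivity)
  rw [Real.mul_rpow (by positivity) (by positivity), ← Real.rpow_mul hs.le,
    show 2 * c * s ^ r / 2 = c * s ^ r by ring] at h
  have e : s ^ (r * k) = s ^ r * s ^ 2 := by
    rw [hk, show r * (1 + 2 / r) = r + (2:ℕ) by field_simp; norm_num, Real.rpow_add hs, Real.rpow_natCast]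
  rw [e] at h
  rw [Real.exp_neg, ← div_eq_mul_inv, div_le_div_iff₀ (Real.exp_pos _) (by positivity)]
  linarith

lemma main_limit (a : ℕ → ℕ) (r y : ℝ) (hr : 0 < r) (hy : 1 ≤ y)
    (hexp : ExpansiveCond a r y)
    (σ : ℕ → ℝ) (hσ : ∀ n : ℕ, 1 ≤ n → 0 < σ n ∧ Mfun a n (σ n) = n) :
    Tendsto (fun n : ℕ => ((Real.sqrt (2 * Real.pi * B2 a n (σ n)) : ℝ) : ℂ) *
        ∫ α in (0:ℝ)..1, FF a n (σ n) α) atTop (nhds 1) := by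
  obtain ⟨D₁, D₂, hD₁, hD₂, hD⟩ := hexp
  have hb := fun j hj => (hD j hj).1
  have hb2 := fun j hj => (hD j hj).2
  obtain ⟨C, c, hC, hc, hT, hev⟩ := params a r y D₁ D₂ hr hy hD₁ hD₂ hb hb2 σ hσ
  obtain ⟨d, hd, hdec⟩ := phi_decay a r y D₁ hr hy hD₁ hb
  have hpi := Real.pi_pos
  set s : ℕ → ℝ := fun n => (σ n - Real.log y)⁻¹ with hs
  set B : ℕ → ℝ := fun n => Real.sqrt (B2 a n (σ n)) with hB
  have hδs : ∀ n, σ n - Real.log y = (s n)⁻¹ := fun n => by rw [hs]; simp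
  set G : ℕ → ℝ → ℂ := fun n => (Set.Ioc (-(Real.pi * B n)) (Real.pi * B n)).indicator
    (fun t => FF a n (σ n) (t / (2 * Real.pi * B n))) with hG
  -- properties
  have hprop : ∀ᶠ n : ℕ in atTop, 1 ≤ n ∧ 0 < σ n ∧ 8 ≤ s n ∧ 2 * s n ≤ n ∧ 0 < B n ∧
      Tk a n (σ n) 2 = B n ^ 2 ∧
      c * (s n ^ r * s n ^ 2) ≤ B n ^ 2 ∧ B n ^ 2 ≤ C * (s n ^ r * s n ^ 2) ∧
      Tk a n (σ n) 3 ≤ C * (s n ^ r * s n ^ 3) := by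
    filter_upwards [hev] with n ⟨h1, h2, h3, h4, h5, h6⟩
    have hs0 : 0 < s n := by linarith
    have hpos : 0 < B2 a n (σ n) := by
      rw [B2_eq]; exact lt_of_lt_of_le (by positivity) h4
    have hBsq : Tk a n (σ n) 2 = B n ^ 2 := by rw [hB, Real.sq_sqrt hpos.le, B2_eq]
    refine ⟨h1, (hσ n h1).1, h2, h3, Real.sqrt_pos.2 hpos, hBsq, ?_, ?_, h6⟩
    · rw [← hBsq]; exact h4
    · rw [← hBsq]; exact h5
  -- ratio s/B tends to zero
  have hrho : Tendsto (fun n => s n / B n) atTop (nhds 0) := by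
    have h1 : Tendsto (fun n => Real.sqrt ((c * s n ^ r)⁻¹)) atTop (nhds 0) := by
      rw [← Real.sqrt_zero]
      refine (Real.continuous_sqrt.tendsto 0).comp (tendsto_inv_atTop_zero.comp ?_)
      exact Tendsto.const_mul_atTop hc ((tendsto_rpow_atTop hr).comp hT)
    refine tendsto_of_tendsto_of_tendsto_of_le_of_le' tendsto_const_nhds h1 ?_ ?_
    · filter_upwards [hprop] with n ⟨_, _, h8, _, hBp, _⟩
      have : 0 < s n := by linarith
      positivity
    · filter_upwards [hprop] with n ⟨_, _, h8, _, hBp, _, hl, _⟩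
      have : 0 < s n := by linarith
      apply Real.le_sqrt_of_sq_le
      rw [div_pow, div_le_iff₀ (by positivity), inv_mul_eq_div, le_div_iff₀ (by positivity)]
      linarith
  have hBtop : Tendsto B atTop atTop := by
    rw [tendsto_atTop]
    intro A
    filter_upwards [hprop, hrho.eventually (gt_mem_nhds (zero_lt_one)), hT.eventually_ge_atTop A] with n ⟨_, _, h8, _, hBp, _⟩ h1 h2
    rw [div_lt_one hBp] at h1
    have : A ≤ s n := h2
    linarith
  -- domination
  obtain ⟨K2, hK2, hK2b⟩ := rpow_exp_aux r d hr hd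
  set c' := d / (4 * Real.pi ^ 2 * C) with hc'
  have hc'p : 0 < c' := by positivity
  set K := (1 + 1 / c') + (1 + Real.pi ^ 2 * C) * K2 with hK
  have hdom : ∀ᶠ n : ℕ in atTop, ∀ t : ℝ, ‖G n t‖ ≤ K * (1 + t ^ 2)⁻¹ := by
    filter_upwards [hprop] with n ⟨h1, hσp, h8, h2s, hBp, hB2, hl, hu, hT3⟩ t
    have hs0 : 0 < s n := by linarith
    rw [hG]
    by_cases ht : t ∈ Set.Ioc (-(Real.pi * B n)) (Real.pi * B n)
    swap
    · simp only [Set.indicator_of_notMem ht, norm_zero]; positivity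
    simp only [Set.indicator_of_mem ht]
    rw [FF_norm, ← div_eq_mul_inv, le_div_iff₀ (by positivity)]
    have habs : |t| ≤ Real.pi * B n := abs_le.2 ⟨ht.1.le, ht.2⟩
    have hα : |t / (2 * Real.pi * B n)| ≤ 1 / 2 := by
      rw [abs_div, abs_of_pos (by positivity : 0 < 2 * Real.pi * B n), div_le_iff₀ (by positivity)]
      linarith
    rcases hdec (σ n) n (s n) hσp (hδs n) h8 h2s _ hα with h | h
    · have hE : c' * t ^ 2 ≤ d * (s n ^ r * (s n ^ 2 * (t / (2 * Real.pi * B n)) ^ 2)) := by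
        have : d * (s n ^ r * (s n ^ 2 * (t / (2 * Real.pi * B n)) ^ 2)) =
          (d * t ^ 2 / (4 * Real.pi ^ 2)) * ((s n ^ r * s n ^ 2) / B n ^ 2) := by
          field_simp; norm_num
        rw [this]
        have h3 : 1 / C ≤ (s n ^ r * s n ^ 2) / B n ^ 2 := by
          rw [div_le_div_iff₀ hC (by positivity)]; linarith
        calc c' * t ^ 2 = (d * t ^ 2 / (4 * Real.pi ^ 2)) * (1 / C) := by rw [hc']; field_simp
          _ ≤ _ := by gcongr
      have h4 : ‖phi a n (σ n) (t / (2 * Real.pi * B n))‖ ≤ 1 / (1 + c' * t ^ 2) := by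
        refine h.trans ((Real.exp_le_exp.2 (neg_le_neg hE)).trans ?_)
        rw [Real.exp_neg, ← one_div]
        apply one_div_le_one_div_of_le (by positivity)
        linarith [Real.add_one_le_exp (c' * t ^ 2)]
      calc _ ≤ 1 / (1 + c' * t ^ 2) * (1 + t ^ 2) := by gcongr
        _ ≤ 1 + 1 / c' := by
          rw [div_mul_eq_mul_div, div_le_iff₀ (by positivity)]
          have : (1 + 1 / c') * (1 + c' * t ^ 2) = 1 + 1 / c' + c' * t ^ 2 + t ^ 2 := by field_simp; ring
          rw [this]
          have : 0 ≤ c' * t ^ 2 := by positivity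
          have : 0 < 1 / c' := by positivity
          linarith
        _ ≤ K := by rw [hK]; have : 0 ≤ (1 + Real.pi ^ 2 * C) * K2 := by positivity
                    linarith
    · have h3 : 1 ≤ s n ^ r * s n ^ 2 := by
        have := Real.one_le_rpow (by linarith : 1 ≤ s n) hr.le
        have : 1 ≤ s n ^ 2 := by nlinarith
        nlinarith
      have h4 : 1 + t ^ 2 ≤ (1 + Real.pi ^ 2 * C) * (s n ^ r * s n ^ 2) := by
        have h5 : t ^ 2 ≤ (Real.pi * B n) ^ 2 := sq_le_sq' (by linarith [ht.1]) ht.2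
        have h6 : Real.pi ^ 2 * B n ^ 2 ≤ Real.pi ^ 2 * (C * (s n ^ r * s n ^ 2)) := by gcongr
        rw [mul_pow] at h5
        linarith
      calc _ ≤ Real.exp (-(d * s n ^ r)) * ((1 + Real.pi ^ 2 * C) * (s n ^ r * s n ^ 2)) := by gcongr
        _ = (1 + Real.pi ^ 2 * C) * ((s n ^ r * s n ^ 2) * Real.exp (-(d * s n ^ r))) := by ring
        _ ≤ (1 + Real.pi ^ 2 * C) * K2 := by gcongr; exact hK2b _ hs0
        _ ≤ K := by rw [hK]; have : 0 < 1 + 1 / c' := by positivity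
                    linarith
  -- pointwise convergence
  have hpt : ∀ t : ℝ, Tendsto (fun n => G n t) atTop (nhds ((Real.exp (-(1/2) * t ^ 2) : ℝ) : ℂ)) := by
    intro t
    have hex : ∀ᶠ n : ℕ in atTop, ∃ E : ℂ, G n t = Complex.exp E ∧
        ‖E - ((-(1/2) * t ^ 2 : ℝ) : ℂ)‖ ≤ (4 * |t| ^ 3 * (C / c)) * (s n / B n) := by
      have hsm1 : Tendsto (fun n => s n / B n * |t|) atTop (nhds 0) := by
        simpa using hrho.mul_const |t|
      filter_upwards [hprop, hsm1.eventually (gt_mem_nhds (by norm_num : (0:ℝ) < 1/2)),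
        hBtop.eventually_gt_atTop |t|] with n ⟨h1, hσp, h8, h2s, hBp, hB2, hl, hu, hT3⟩ h9 h10
      have hs0 : 0 < s n := by linarith
      have hlog := Real.log_nonneg hy
      have hsσ : (s n)⁻¹ ≤ σ n := by rw [← hδs n]; linarith
      have hmem : t ∈ Set.Ioc (-(Real.pi * B n)) (Real.pi * B n) := by
        have : B n ≤ Real.pi * B n := by nlinarith [Real.pi_gt_three]
        have := abs_lt.1 h10
        exact ⟨by linarith, by linarith⟩
      obtain ⟨E, hE1, hE2⟩ := phi_exp a n (σ n) (t / (2 * Real.pi * B n)) (t / B n) hσp (by field_simp) (by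
        intro j hj
        have := small_p (σ n) (s n) hs0 hsσ j (Finset.mem_Icc.1 hj).1
        rw [abs_mul, abs_of_nonneg (Nat.cast_nonneg j : (0:ℝ) ≤ j), ← mul_assoc, abs_div, abs_of_pos hBp]
        refine (mul_le_mul_of_nonneg_right this (by positivity)).trans ?_
        rw [← mul_div_assoc, ← div_mul_eq_mul_div]; exact h9.le)
      refine ⟨E - Complex.I * (t / B n : ℝ) * n, ?_, ?_⟩
      · rw [hG]
        simp only [Set.indicator_of_mem hmem]
        unfold FF
        rw [hE1, ← Complex.exp_add, sub_eq_add_neg]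
        congr 3
        have : (B n : ℂ) ≠ 0 := by exact_mod_cast hBp.ne'
        have : (Real.pi : ℂ) ≠ 0 := by exact_mod_cast hpi.ne'
        push_cast
        field_simp
      · rw [← Mfun_eq, (hσ n h1).2, hB2] at hE2
        have e : E - Complex.I * (t / B n : ℝ) * n - ((-(1/2) * t ^ 2 : ℝ) : ℂ) =
            E - (Complex.I * ((t / B n : ℝ) : ℂ) * ((n : ℝ) : ℂ) - ((t / B n : ℝ) : ℂ) ^ 2 * ((B n ^ 2 : ℝ) : ℂ) / 2) := by
          have : (B n : ℂ) ≠ 0 := by exact_mod_cast hBp.ne'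
          push_cast
          field_simp
          ring
        rw [e]
        refine hE2.trans ?_
        have h11 : Tk a n (σ n) 3 ≤ C / c * (B n ^ 2 * s n) := by
          refine hT3.trans ?_
          calc C * (s n ^ r * s n ^ 3) = C / c * ((c * (s n ^ r * s n ^ 2)) * s n) := by field_simp
            _ ≤ _ := by gcongr
        calc 4 * (|t / B n| ^ 3 * Tk a n (σ n) 3) ≤ 4 * (|t / B n| ^ 3 * (C / c * (B n ^ 2 * s n))) := by gcongr
          _ = _ := by rw [abs_div, abs_of_pos hBp]; field_simp
    have hex2 : ∀ n, ∃ E : ℂ, (∃ E : ℂ, G n t = Complex.exp E ∧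
        ‖E - ((-(1/2) * t ^ 2 : ℝ) : ℂ)‖ ≤ (4 * |t| ^ 3 * (C / c)) * (s n / B n)) → G n t = Complex.exp E ∧
        ‖E - ((-(1/2) * t ^ 2 : ℝ) : ℂ)‖ ≤ (4 * |t| ^ 3 * (C / c)) * (s n / B n) := by
      intro n
      by_cases h : ∃ E : ℂ, G n t = Complex.exp E ∧
        ‖E - ((-(1/2) * t ^ 2 : ℝ) : ℂ)‖ ≤ (4 * |t| ^ 3 * (C / c)) * (s n / B n)
      · obtain ⟨E, hE⟩ := h
        exact ⟨E, fun _ => hE⟩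
      · exact ⟨0, fun h' => absurd h' h⟩
    choose E hE using hex2
    have hEt : Tendsto E atTop (nhds ((-(1/2) * t ^ 2 : ℝ) : ℂ)) := by
      rw [tendsto_iff_norm_sub_tendsto_zero]
      refine tendsto_of_tendsto_of_tendsto_of_le_of_le' tendsto_const_nhds
        (by simpa using hrho.const_mul (4 * |t| ^ 3 * (C / c))) (Eventually.of_forall fun _ => norm_nonneg _) ?_
      filter_upwards [hex] with n hn
      exact (hE n hn).2
    rw [Complex.ofReal_exp]
    refine Tendsto.congr' ?_ ((Complex.continuous_exp.tendsto _).comp hEt)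
    filter_upwards [hex] with n hn
    exact (hE n hn).1.symm
  -- dominated convergence
  have hlim : Tendsto (fun n => ∫ t, G n t) atTop (nhds (∫ t : ℝ, ((Real.exp (-(1/2) * t ^ 2) : ℝ) : ℂ))) := by
    refine MeasureTheory.tendsto_integral_filter_of_dominated_convergence (fun t => K * (1 + t ^ 2)⁻¹) ?_ ?_ ?_ ?_
    · refine Eventually.of_forall fun n => ?_
      refine (Measurable.indicator ?_ measurableSet_Ioc).aestronglyMeasurable
      exact (FF_meas a n (σ n)).comp (measurable_id.div_const _)
    · filter_upwards [hdom] with n hn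
      exact Eventually.of_forall hn
    · exact integrable_inv_one_add_sq.const_mul K
    · exact Eventually.of_forall hpt
  rw [integral_complex_ofReal, integral_gaussian, show Real.pi / (1/2) = 2 * Real.pi by ring] at hlim
  have hfin := hlim.const_mul (((Real.sqrt (2 * Real.pi) : ℝ) : ℂ)⁻¹)
  have h0 : ((Real.sqrt (2 * Real.pi) : ℝ) : ℂ) ≠ 0 := by
    have : 0 < Real.sqrt (2 * Real.pi) := by positivity
    exact_mod_cast this.ne'
  rw [inv_mul_cancel₀ h0] at hfin
  refine Tendsto.congr' ?_ hfin
  filter_upwards [hprop] with n ⟨_, _, _, _, hBp, hB2, _⟩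
  rw [B2_eq, hB2, int_scale a n (σ n) (B n) hBp]

/-- local limit theorem: under condition (exp), with `σ = σ_n`,
`∫_0^1 φ(α) e^{-2πiαn} dα ∼ (2π B_n²)^{-1/2}`; i.e. the integral is real and positive
for large `n` and `√(2π B_n²) · ∫_0^1 φ(α) e^{-2πiαn} dα → 1`. -/
theorem local_limit_theorem (a : ℕ → ℕ) (r y : ℝ) (hr : 0 < r) (hy : 1 ≤ y)
    (hexp : ExpansiveCond a r y)
    (σ : ℕ → ℝ) (hσ : ∀ n : ℕ, 1 ≤ n → 0 < σ n ∧ Mfun a n (σ n) = n) :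
    (∃ N : ℕ, ∀ n ≥ N,
      (∫ α in (0:ℝ)..1, phi a n (σ n) α *
        Complex.exp (-(2 * Real.pi * Complex.I * α * n))).im = 0 ∧
      0 < (∫ α in (0:ℝ)..1, phi a n (σ n) α *
        Complex.exp (-(2 * Real.pi * Complex.I * α * n))).re) ∧
    Tendsto (fun n : ℕ =>
      ((Real.sqrt (2 * Real.pi * B2 a n (σ n)) : ℝ) : ℂ) *
        ∫ α in (0:ℝ)..1, phi a n (σ n) α *
          Complex.exp (-(2 * Real.pi * Complex.I * α * n)))
      atTop (nhds 1) := by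
  have hlim := main_limit a r y hr hy hexp σ hσ
  refine ⟨?_, hlim⟩
  have h1 : ∀ᶠ n : ℕ in atTop, 0 < (((Real.sqrt (2 * Real.pi * B2 a n (σ n)) : ℝ) : ℂ) *
        ∫ α in (0:ℝ)..1, FF a n (σ n) α).re := by
    have := (Complex.continuous_re.tendsto 1).comp hlim
    exact this.eventually (lt_mem_nhds (by norm_num))
  obtain ⟨N, hN⟩ := eventually_atTop.1 h1
  refine ⟨N, fun n hn => ⟨int_real a n (σ n), ?_⟩⟩
  have h2 := hN n hn
  rw [Complex.re_ofReal_mul] at h2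
  exact pos_of_mul_pos_right h2 (Real.sqrt_nonneg _)
end

section
/- Assume condition (exp) and set α_0(n) = δ_n^{(r+2)/2} · log n. Then there exist a constant C > 0 and N such that for all n ≥ N, | ∫_{−1/2}^{−α_0(n)} φ(α) e^{−2πiαn} dα + ∫_{α_0(n)}^{1/2} φ(α) e^{−2πiαn} dα | ≤ exp(−C log² n). -/
open Finset Filter

lemma factor_bound (x θ : ℝ) (hx0 : 0 < x) (hx1 : x < 1) :
    ‖(((1 - x : ℝ) : ℂ) / (1 - (x : ℂ) * Complex.exp (2 * θ * Complex.I)))‖ ≤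
      Real.exp (-(2/5 * x * Real.sin θ ^ 2)) := by
  set s := Real.sin θ ^ 2 with hs
  have hs0 : 0 ≤ s := sq_nonneg _
  have hs1 : s ≤ 1 := Real.sin_sq_le_one θ
  have hden : ‖(1 - (x : ℂ) * Complex.exp (2 * θ * Complex.I))‖ ^ 2 = (1 - x) ^ 2 + 4 * x * s := by
    have h1 : Complex.exp (2 * θ * Complex.I) =
        ((Real.cos (2 * θ) : ℝ) : ℂ) + ((Real.sin (2 * θ) : ℝ) : ℂ) * Complex.I := by
      rw [Complex.exp_mul_I]; push_cast; rfl
    have h2 : (1 - (x : ℂ) * Complex.exp (2 * θ * Complex.I)) =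
        ((1 - x * Real.cos (2 * θ) : ℝ) : ℂ) + ((-(x * Real.sin (2 * θ)) : ℝ) : ℂ) * Complex.I := by
      rw [h1]; push_cast; ring
    rw [h2, ← Complex.normSq_eq_norm_sq, Complex.normSq_add_mul_I]
    have h3 := Real.sin_sq_add_cos_sq (2 * θ)
    have h4 : Real.cos (2 * θ) = 1 - 2 * s := by
      rw [Real.cos_two_mul, hs]; have := Real.sin_sq_add_cos_sq θ; linarith
    have h5 : (1 - x * Real.cos (2 * θ)) ^ 2 + (-(x * Real.sin (2 * θ))) ^ 2 =
      1 - 2 * x * Real.cos (2 * θ) + x ^ 2 := by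
      linear_combination x ^ 2 * h3
    rw [h5, h4]; ring
  have hsq : ‖(((1 - x : ℝ) : ℂ) / (1 - (x : ℂ) * Complex.exp (2 * θ * Complex.I)))‖ ^ 2 ≤
      (Real.exp (-(2/5 * x * s))) ^ 2 := by
    rw [norm_div, div_pow, hden, Complex.norm_real, Real.norm_eq_abs, sq_abs, ← Real.exp_nat_mul]
    have hp : 0 < (1 - x) ^ 2 := by have : 0 < 1 - x := by linarith
                                    positivity
    have hxs : 0 ≤ x * s := by positivity
    have hxs1 : x * s ≤ 1 := by nlinarith
    have h6 : (1 - x) ^ 2 / ((1 - x) ^ 2 + 4 * x * s) ≤ 1 - 4/5 * (x * s) := by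
      rw [div_le_iff₀ (by nlinarith)]
      have h7 : (1 - x) ^ 2 ≤ 1 := by nlinarith
      nlinarith [mul_nonneg hxs (sub_nonneg.2 h7), mul_nonneg hxs (sub_nonneg.2 hxs1)]
    refine h6.trans ?_
    have := Real.add_one_le_exp (((2:ℕ):ℝ) * -(2/5 * x * s))
    push_cast at this ⊢
    linarith
  exact le_of_sq_le_sq hsq (Real.exp_pos _).le

lemma phi_bound (a : ℕ → ℕ) (n : ℕ) (σ α : ℝ) (hσ : 0 < σ) :
    ‖phi a n σ α‖ ≤ Real.exp (-(2/5 * ∑ j ∈ Finset.Icc 1 n,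
      (a j : ℝ) * Real.exp (-(j * σ)) * Real.sin (Real.pi * |α| * j) ^ 2)) := by
  unfold phi
  rw [norm_prod, Finset.mul_sum, ← Finset.sum_neg_distrib, Real.exp_sum]
  refine Finset.prod_le_prod (fun _ _ => norm_nonneg _) ?_
  intro j hj
  have hj1 : 1 ≤ j := (Finset.mem_Icc.1 hj).1
  have hj0 : (0:ℝ) < j := by exact_mod_cast hj1
  have hx1 : Real.exp (-(j * σ)) < 1 := by
    rw [Real.exp_lt_one_iff]; have := mul_pos hj0 hσ; linarith
  have h := factor_bound (Real.exp (-(j * σ))) (Real.pi * α * j) (Real.exp_pos _) hx1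
  have hs : Real.sin (Real.pi * |α| * j) ^ 2 = Real.sin (Real.pi * α * j) ^ 2 := by
    rcases abs_choice α with h | h <;> rw [h]
    rw [show Real.pi * -α * j = -(Real.pi * α * j) by ring, Real.sin_neg, neg_sq]
  rw [norm_pow, hs]
  have e1 : (2 * ((Real.pi * α * j : ℝ) : ℂ) * Complex.I) = 2 * Real.pi * Complex.I * α * j := by
    push_cast; ring
  rw [e1] at h
  refine (pow_le_pow_left₀ (norm_nonneg _) h _).trans (le_of_eq ?_)
  rw [← Real.exp_nat_mul]
  congr 1; ring

lemma exists_shift (m : ℕ) (hm : 1 ≤ m) (α : ℝ) (h0 : 0 ≤ α) (h1 : α ≤ 1/2) :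
    ∃ k : ℕ, 1 ≤ k ∧ k ≤ m ∧ min (1/4) (4 * α ^ 2 * m ^ 2) ≤ Real.sin (Real.pi * α * k) ^ 2 := by
  have key : ∀ k : ℕ, α * k ≤ 1/2 → 2 * (α * k) ≤ Real.sin (Real.pi * α * k) := by
    intro k hk
    have hp := Real.pi_pos
    have hak : 0 ≤ α * k := by positivity
    have := Real.mul_le_sin (x := Real.pi * α * k) (by positivity) (by nlinarith)
    refine le_trans (le_of_eq ?_) this
    field_simp
  have hm0 : (0:ℝ) < m := by exact_mod_cast hm
  by_cases h : α * m ≤ 1/2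
  · refine ⟨m, hm, le_rfl, (min_le_right _ _).trans ?_⟩
    have := pow_le_pow_left₀ (by positivity) (key m h) 2
    refine le_trans (le_of_eq ?_) this
    ring
  · push Not at h
    have hα : 0 < α := by
      rcases h0.eq_or_lt with h' | h'
      · rw [← h'] at h; norm_num at h
      · exact h'
    set k := ⌊1 / (2 * α)⌋₊ with hk
    have hle : (k:ℝ) ≤ 1 / (2 * α) := Nat.floor_le (by positivity)
    have hlt : 1 / (2 * α) < k + 1 := Nat.lt_floor_add_one _
    rw [le_div_iff₀ (by positivity)] at hle
    rw [div_lt_iff₀ (by positivity)] at hlt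
    have hk1 : 1 ≤ k := by
      rw [hk, Nat.one_le_floor_iff, le_div_iff₀ (by positivity)]; linarith
    have hk1' : (1:ℝ) ≤ k := by exact_mod_cast hk1
    refine ⟨k, hk1, ?_, (min_le_left _ _).trans ?_⟩
    · have : (k:ℝ) < m := by
        by_contra hc; push Not at hc; nlinarith
      exact_mod_cast this.le
    · have h2 := key k (by linarith)
      have h3 : 1/4 ≤ α * k := by nlinarith
      nlinarith

lemma window_sum (m : ℕ) (hm : 1 ≤ m) (α : ℝ) (h0 : 0 ≤ α) (h1 : α ≤ 1/2) :
    (m:ℝ) / 4 * min (1/4) (4 * α ^ 2 * m ^ 2) ≤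
      ∑ j ∈ Finset.Ico m (3 * m), Real.sin (Real.pi * α * j) ^ 2 := by
  obtain ⟨k, hk1, hkm, hk⟩ := exists_shift m hm α h0 h1
  set T := ∑ j ∈ Finset.Ico m (3 * m), Real.sin (Real.pi * α * j) ^ 2 with hT
  have hA : ∑ j ∈ Finset.Ico m (2 * m), Real.sin (Real.pi * α * j) ^ 2 ≤ T := by
    refine Finset.sum_le_sum_of_subset_of_nonneg ?_ (fun _ _ _ => sq_nonneg _)
    exact Finset.Ico_subset_Ico le_rfl (by omega)
  have hB : ∑ j ∈ Finset.Ico m (2 * m), Real.sin (Real.pi * α * (j + k : ℕ)) ^ 2 ≤ T := by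
    rw [Finset.sum_Ico_add' (fun j : ℕ => Real.sin (Real.pi * α * (j : ℕ)) ^ 2)]
    refine Finset.sum_le_sum_of_subset_of_nonneg ?_ (fun _ _ _ => sq_nonneg _)
    exact Finset.Ico_subset_Ico (by omega) (by omega)
  have hC : ∑ j ∈ Finset.Ico m (2 * m), (min (1/4) (4 * α ^ 2 * m ^ 2) / 2) ≤
      ∑ j ∈ Finset.Ico m (2 * m), (Real.sin (Real.pi * α * j) ^ 2 +
        Real.sin (Real.pi * α * (j + k : ℕ)) ^ 2) := by
    refine Finset.sum_le_sum (fun j _ => ?_)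
    have h3 : Real.sin (Real.pi * α * k) =
        Real.sin (Real.pi * α * (j + k : ℕ)) * Real.cos (Real.pi * α * j) -
        Real.cos (Real.pi * α * (j + k : ℕ)) * Real.sin (Real.pi * α * j) := by
      rw [← Real.sin_sub]; congr 1; push_cast; ring
    have h4 : Real.sin (Real.pi * α * k) ^ 2 ≤ 2 * (Real.sin (Real.pi * α * j) ^ 2 +
        Real.sin (Real.pi * α * (j + k : ℕ)) ^ 2) := by
      rw [h3]
      generalize Real.pi * α * (j + k : ℕ) = u
      generalize Real.pi * α * j = v
      have c1 := Real.cos_sq_le_one u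
      have c2 := Real.cos_sq_le_one v
      nlinarith [sq_nonneg (Real.sin u * Real.cos v + Real.cos u * Real.sin v),
        mul_nonneg (sq_nonneg (Real.sin u)) (sub_nonneg.2 c2),
        mul_nonneg (sq_nonneg (Real.sin v)) (sub_nonneg.2 c1)]
    linarith
  rw [Finset.sum_add_distrib, Finset.sum_const, Nat.card_Ico, nsmul_eq_mul,
    show 2 * m - m = m by omega] at hC
  linarith

/-- lower bound for the exponent -/
lemma exponent_lower (a : ℕ → ℕ) (r y D σ α : ℝ) (hr : 0 < r) (hy : 1 ≤ y) (hD : 0 < D)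
    (ha : ∀ j : ℕ, 1 ≤ j → D * (j : ℝ) ^ (r - 1) * y ^ j ≤ (a j : ℝ))
    (n m : ℕ) (hm : 1 ≤ m) (hmn : 3 * m ≤ n) (hmδ : m * (σ - Real.log y) ≤ 1)
    (hδ : 0 < σ - Real.log y)
    (h0 : 0 ≤ α) (h1 : α ≤ 1/2) :
    D * Real.exp (-3) / 12 * ((m:ℝ) ^ r * min (1/4) (4 * α ^ 2 * m ^ 2)) ≤
    ∑ j ∈ Finset.Icc 1 n,
      (a j : ℝ) * Real.exp (-(j * σ)) * Real.sin (Real.pi * α * j) ^ 2 := by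
  have hm0 : (0:ℝ) < m := by exact_mod_cast hm
  have hw := window_sum m hm α h0 h1
  have hsub : ∑ j ∈ Finset.Ico m (3 * m),
      (a j : ℝ) * Real.exp (-(j * σ)) * Real.sin (Real.pi * α * j) ^ 2 ≤
      ∑ j ∈ Finset.Icc 1 n,
      (a j : ℝ) * Real.exp (-(j * σ)) * Real.sin (Real.pi * α * j) ^ 2 := by
    refine Finset.sum_le_sum_of_subset_of_nonneg ?_ (fun _ _ _ => by positivity)
    intro j hj
    rw [Finset.mem_Ico] at hj; rw [Finset.mem_Icc]; omega
  refine le_trans ?_ hsub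
  have hterm : ∑ j ∈ Finset.Ico m (3 * m), (D * Real.exp (-3) * ((m:ℝ) ^ r / (3 * m))) *
      Real.sin (Real.pi * α * j) ^ 2 ≤ ∑ j ∈ Finset.Ico m (3 * m),
      (a j : ℝ) * Real.exp (-(j * σ)) * Real.sin (Real.pi * α * j) ^ 2 := by
    refine Finset.sum_le_sum (fun j hj => ?_)
    rw [Finset.mem_Ico] at hj
    refine mul_le_mul_of_nonneg_right ?_ (sq_nonneg _)
    have hj1 : 1 ≤ j := by omega
    have hj0 : (0:ℝ) < j := by exact_mod_cast hj1
    have hjm : (m:ℝ) ≤ j := by exact_mod_cast hj.1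
    have hj3 : (j:ℝ) ≤ 3 * m := by exact_mod_cast hj.2.le
    have hexp : y ^ j * Real.exp (-(j * σ)) = Real.exp (-(j * (σ - Real.log y))) := by
      have : y ^ j = Real.exp (j * Real.log y) := by
        rw [Real.exp_nat_mul, Real.exp_log (by linarith)]
      rw [this, ← Real.exp_add]; congr 1; ring
    have he3 : Real.exp (-3) ≤ y ^ j * Real.exp (-(j * σ)) := by
      rw [hexp, Real.exp_le_exp]; nlinarith
    have hpow : (m:ℝ) ^ r / (3 * m) ≤ (j:ℝ) ^ (r - 1) := by
      rw [Real.rpow_sub hj0, Real.rpow_one]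
      exact div_le_div₀ (by positivity) (Real.rpow_le_rpow hm0.le hjm hr.le) hj0 hj3
    calc D * Real.exp (-3) * ((m:ℝ) ^ r / (3 * m))
        ≤ D * (y ^ j * Real.exp (-(j * σ))) * (j:ℝ) ^ (r - 1) := by gcongr
      _ = (D * (j : ℝ) ^ (r - 1) * y ^ j) * Real.exp (-(j * σ)) := by ring
      _ ≤ _ := mul_le_mul_of_nonneg_right (ha j hj1) (Real.exp_pos _).le
  refine le_trans ?_ hterm
  rw [← Finset.mul_sum]
  refine le_trans (le_of_eq ?_) (mul_le_mul_of_nonneg_left hw (by positivity))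
  field_simp
  ring

/-- lower bound on `δ` -/
lemma delta_lower (a : ℕ → ℕ) (r y D : ℝ) (hr : 0 < r) (hy : 1 ≤ y) (hD : 0 < D)
    (ha : ∀ j : ℕ, 1 ≤ j → D * (j : ℝ) ^ (r - 1) * y ^ j ≤ (a j : ℝ))
    (n : ℕ) (hn : 1 ≤ n) (σ : ℝ) (hσ : 0 < σ) (hM : Mfun a n σ = n)
    (hbig : 1 < D * Real.exp (-3) * ((n:ℝ) / 2) ^ r / 2) :
    3 < n * (σ - Real.log y) := by
  by_contra hc
  push Not at hc
  have hn0 : (0:ℝ) < n := by exact_mod_cast hn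
  have hsub : ∑ j ∈ Finset.Icc ((n + 1) / 2) n, (j : ℝ) * (a j) * Real.exp (-(j * σ)) / (1 - Real.exp (-(j * σ))) ≤ Mfun a n σ := by
    unfold Mfun
    refine Finset.sum_le_sum_of_subset_of_nonneg ?_ ?_
    · intro j hj
      rw [Finset.mem_Icc] at hj ⊢; omega
    · intro j hj _
      have : Real.exp (-(j * σ)) ≤ 1 := by
        rw [Real.exp_le_one_iff]; have : 0 ≤ j * σ := by positivity
        linarith
      have : 0 ≤ 1 - Real.exp (-(j * σ)) := by linarith
      positivity
  have hterm : ∑ j ∈ Finset.Icc ((n + 1) / 2) n, (D * Real.exp (-3) * ((n:ℝ) / 2) ^ r) ≤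
      ∑ j ∈ Finset.Icc ((n + 1) / 2) n, (j : ℝ) * (a j) * Real.exp (-(j * σ)) / (1 - Real.exp (-(j * σ))) := by
    refine Finset.sum_le_sum (fun j hj => ?_)
    rw [Finset.mem_Icc] at hj
    have hj1 : 1 ≤ j := by omega
    have hj0 : (0:ℝ) < j := by exact_mod_cast hj1
    have hjn : (j:ℝ) ≤ n := by exact_mod_cast hj.2
    have hj2 : (n:ℝ) / 2 ≤ j := by
      have : n ≤ 2 * j := by omega
      have : (n:ℝ) ≤ 2 * j := by exact_mod_cast this
      linarith
    have hx1 : Real.exp (-(j * σ)) < 1 := by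
      rw [Real.exp_lt_one_iff]; have := mul_pos hj0 hσ; linarith
    have hexp : y ^ j * Real.exp (-(j * σ)) = Real.exp (-(j * (σ - Real.log y))) := by
      have : y ^ j = Real.exp (j * Real.log y) := by
        rw [Real.exp_nat_mul, Real.exp_log (by linarith)]
      rw [this, ← Real.exp_add]; congr 1; ring
    have he3 : Real.exp (-3) ≤ y ^ j * Real.exp (-(j * σ)) := by
      rw [hexp, Real.exp_le_exp]
      rcases le_total 0 (σ - Real.log y) with h | h <;> nlinarith
    rw [le_div_iff₀ (by linarith)]
    have hrp : (j:ℝ) * (j:ℝ) ^ (r - 1) = (j:ℝ) ^ r := by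
      rw [Real.rpow_sub hj0, Real.rpow_one]; field_simp
    calc D * Real.exp (-3) * ((n:ℝ) / 2) ^ r * (1 - Real.exp (-(j * σ)))
        ≤ D * Real.exp (-3) * ((n:ℝ) / 2) ^ r * 1 := by
          refine mul_le_mul_of_nonneg_left ?_ (by positivity)
          have := Real.exp_pos (-(j * σ)); linarith
      _ ≤ D * (y ^ j * Real.exp (-(j * σ))) * (j:ℝ) ^ r := by
          rw [mul_one]; gcongr
      _ = j * (D * (j : ℝ) ^ (r - 1) * y ^ j) * Real.exp (-(j * σ)) := by rw [← hrp]; ring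
      _ ≤ _ := by
          have := ha j hj1
          gcongr
  rw [Finset.sum_const, Nat.card_Icc, nsmul_eq_mul] at hterm
  have hcard : (n:ℝ) / 2 ≤ ((n + 1 - (n + 1) / 2 : ℕ) : ℝ) := by
    have : n ≤ 2 * (n + 1 - (n + 1) / 2) := by omega
    have : (n:ℝ) ≤ 2 * ((n + 1 - (n + 1) / 2 : ℕ) : ℝ) := by exact_mod_cast this
    linarith
  have hpos : 0 ≤ D * Real.exp (-3) * ((n:ℝ) / 2) ^ r := by positivity
  have := mul_le_mul_of_nonneg_right hcard hpos
  nlinarith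

/-- upper bound on `δ` -/
lemma delta_upper (a : ℕ → ℕ) (r y D : ℝ) (hy : 1 ≤ y) (hD : 0 < D)
    (ha : ∀ j : ℕ, 1 ≤ j → (a j : ℝ) ≤ D * (j : ℝ) ^ (r - 1) * y ^ j)
    (p : ℕ) (hp : r + 2 ≤ p)  (hp0 : p ≠ 0)
    (n : ℕ) (σ : ℝ) (hσ : 0 < σ) (hM : Mfun a n σ = n) (hδ : 0 < σ - Real.log y) :
    (n:ℝ) * (σ - Real.log y) ^ p ≤ D * p.factorial * ∑' j : ℕ, 1 / (j:ℝ) ^ 2 := by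
  set δ := σ - Real.log y with hδd
  have hsum : Summable (fun j : ℕ => 1 / (j:ℝ) ^ 2) :=
    Real.summable_one_div_nat_pow.2 (by norm_num)
  have hterm : Mfun a n σ ≤ ∑ j ∈ Finset.Icc 1 n, (D * p.factorial / δ ^ p) * (1 / (j:ℝ) ^ 2) := by
    unfold Mfun
    refine Finset.sum_le_sum (fun j hj => ?_)
    have hj1 : 1 ≤ j := (Finset.mem_Icc.1 hj).1
    have hj0 : (0:ℝ) < j := by exact_mod_cast hj1
    have hj1' : (1:ℝ) ≤ j := by exact_mod_cast hj1
    have hx1 : Real.exp (-(j * σ)) < 1 := by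
      rw [Real.exp_lt_one_iff]; have := mul_pos hj0 hσ; linarith
    have hexp : y ^ j * Real.exp (-(j * σ)) = Real.exp (-(j * δ)) := by
      have : y ^ j = Real.exp (j * Real.log y) := by
        rw [Real.exp_nat_mul, Real.exp_log (by linarith)]
      rw [this, ← Real.exp_add]; congr 1; rw [hδd]; ring
    have hjδ : 0 < j * δ := by positivity
    have hyj : 1 ≤ y ^ j := one_le_pow₀ hy
    have hx2 : Real.exp (-(j * σ)) ≤ Real.exp (-(j * δ)) := by
      rw [← hexp]; have := Real.exp_pos (-(j * σ)); nlinarith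
    have hx3 : Real.exp (-(j * δ)) < 1 := by
      rw [Real.exp_lt_one_iff]; linarith
    have hE : (j * δ) ^ p / p.factorial ≤ Real.exp (j * δ) - 1 := by
      have h := Real.sum_le_exp_of_nonneg hjδ.le (p + 1)
      rw [Finset.sum_range_succ] at h
      have h2 : (1:ℝ) ≤ ∑ i ∈ Finset.range p, (j * δ) ^ i / (i.factorial : ℝ) := by
        have := Finset.single_le_sum (f := fun i : ℕ => (j * δ) ^ i / (i.factorial : ℝ))
          (s := Finset.range p) (fun i _ => by positivity)
          (Finset.mem_range.2 (Nat.pos_of_ne_zero hp0))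
        simpa using this
      linarith
    have hEpos : 0 < (j * δ) ^ p / p.factorial := by positivity
    have hinv : Real.exp (-(j * δ)) * Real.exp (j * δ) = 1 := by
      rw [← Real.exp_add]; simp
    have hq : Real.exp (-(j * δ)) / (1 - Real.exp (-(j * δ))) ≤ p.factorial / (j * δ) ^ p := by
      have e1 : Real.exp (-(j * δ)) / (1 - Real.exp (-(j * δ))) = 1 / (Real.exp (j * δ) - 1) := by
        rw [div_eq_div_iff (by linarith) (by linarith)]
        linarith
      rw [e1, ← one_div_div ((j * δ) ^ p) (p.factorial : ℝ)]
      exact one_div_le_one_div_of_le hEpos hE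
    have hrp : (j:ℝ) * (j:ℝ) ^ (r - 1) = (j:ℝ) ^ r := by
      rw [Real.rpow_sub hj0, Real.rpow_one]; field_simp
    have hrp2 : (j:ℝ) ^ r / (j:ℝ) ^ p ≤ 1 / (j:ℝ) ^ 2 := by
      rw [div_le_div_iff₀ (by positivity) (by positivity), one_mul, ← Real.rpow_natCast,
        ← Real.rpow_natCast, ← Real.rpow_add hj0]
      exact Real.rpow_le_rpow_of_exponent_le hj1' (by push_cast; linarith)
    calc (j : ℝ) * (a j) * Real.exp (-(j * σ)) / (1 - Real.exp (-(j * σ)))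
        ≤ (j : ℝ) * (D * (j : ℝ) ^ (r - 1) * y ^ j) * Real.exp (-(j * σ)) / (1 - Real.exp (-(j * δ))) := by
          have := ha j hj1
          have h1 : 0 < 1 - Real.exp (-(j * δ)) := by linarith
          gcongr
      _ = D * (j:ℝ) ^ r * (Real.exp (-(j * δ)) / (1 - Real.exp (-(j * δ)))) := by
          rw [← hrp, ← hexp]; ring
      _ ≤ D * (j:ℝ) ^ r * (p.factorial / (j * δ) ^ p) := by gcongr
      _ = (D * p.factorial / δ ^ p) * ((j:ℝ) ^ r / (j:ℝ) ^ p) := by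
          rw [mul_pow]; field_simp
      _ ≤ _ := by gcongr
  rw [← Finset.mul_sum, hM] at hterm
  have h2 : ∑ j ∈ Finset.Icc 1 n, (1 / (j:ℝ) ^ 2) ≤ ∑' j : ℕ, 1 / (j:ℝ) ^ 2 :=
    hsum.sum_le_tsum _ (fun _ _ => by positivity)
  have h3 := hterm.trans (mul_le_mul_of_nonneg_left h2 (by positivity))
  calc (n:ℝ) * δ ^ p ≤ ((D * p.factorial / δ ^ p) * ∑' j : ℕ, 1 / (j:ℝ) ^ 2) * δ ^ p := by gcongr
    _ = _ := by field_simp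

/-- eventually conditions -/
lemma ev_log (K s : ℝ) (hs : 0 < s) :
    ∀ᶠ n : ℕ in atTop, (K / (n:ℝ)) ^ s * Real.log n ^ 2 ≤ 1/4 := by
  have h1 := (isLittleO_log_rpow_rpow_atTop (2:ℝ) hs).tendsto_div_nhds_zero
  have h2 := (h1.const_mul (|K| ^ s)).comp tendsto_natCast_atTop_atTop
  rw [mul_zero] at h2
  filter_upwards [h2.eventually (eventually_le_nhds (show (0:ℝ) < 1/4 by norm_num)),
    eventually_ge_atTop 1] with n hn hn1
  have hn0 : (0:ℝ) < n := by exact_mod_cast hn1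
  simp only [Function.comp] at hn
  refine le_trans ?_ hn
  rw [Real.rpow_two]
  have h3 : (K / (n:ℝ)) ^ s ≤ |K| ^ s / (n:ℝ) ^ s := by
    rw [← Real.div_rpow (abs_nonneg _) hn0.le]
    refine (Real.le_norm_self _).trans ?_
    rw [Real.norm_eq_abs]
    refine (Real.abs_rpow_le_abs_rpow _ _).trans (le_of_eq ?_)
    rw [abs_div, abs_of_pos hn0]
  calc _ ≤ |K| ^ s / (n:ℝ) ^ s * Real.log n ^ 2 := by gcongr
    _ = _ := by ring

/-- under condition (exp), with `α₀(n) = δ_n^{(r+2)/2}·log n` where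
`δ_n = σ_n - log y`, there exist `C > 0` and `N` such that for all `n ≥ N`,
`|∫_{-1/2}^{-α₀(n)} φ(α)e^{-2πiαn} dα + ∫_{α₀(n)}^{1/2} φ(α)e^{-2πiαn} dα| ≤ e^{-C log² n}`.
(Here `φ`, given by its defining product formula for all real `α`, is `1`-periodic.) -/
theorem tail_integral_bound (a : ℕ → ℕ) (r y : ℝ) (hr : 0 < r) (hy : 1 ≤ y)
    (hexp : ExpansiveCond a r y)
    (σ : ℕ → ℝ) (hσ : ∀ n : ℕ, 1 ≤ n → 0 < σ n ∧ Mfun a n (σ n) = n) :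
    ∃ C : ℝ, 0 < C ∧ ∃ N : ℕ, ∀ n ≥ N,
      ‖(∫ α in (-(1/2) : ℝ)..(-((σ n - Real.log y) ^ ((r + 2) / 2) * Real.log n)),
          phi a n (σ n) α * Complex.exp (-(2 * Real.pi * Complex.I * α * n))) +
        (∫ α in ((σ n - Real.log y) ^ ((r + 2) / 2) * Real.log n : ℝ)..(1/2),
          phi a n (σ n) α * Complex.exp (-(2 * Real.pi * Complex.I * α * n)))‖ ≤
      Real.exp (-C * (Real.log n) ^ 2) := by
  obtain ⟨D₁, D₂, hD₁, hD₂, hb⟩ := hexp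
  have hb1 := fun j hj => (hb j hj).1
  have hb2 := fun j hj => (hb j hj).2
  obtain ⟨p, hp⟩ := exists_nat_ge (r + 2)
  have hp0' : (0:ℝ) < p := by linarith
  have hp0 : p ≠ 0 := by rintro rfl; simp at hp0'
  set K : ℝ := D₂ * p.factorial * ∑' j : ℕ, 1 / (j:ℝ) ^ 2 with hK
  have hK0 : 0 ≤ K := by
    have : 0 ≤ ∑' j : ℕ, 1 / (j:ℝ) ^ 2 := tsum_nonneg (fun _ => by positivity)
    positivity
  have hev1 : ∀ᶠ n : ℕ in atTop, 1 < D₁ * Real.exp (-3) * ((n:ℝ) / 2) ^ r / 2 := by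
    have h1 : Tendsto (fun n : ℕ => ((n:ℝ) / 2) ^ r) atTop atTop :=
      (tendsto_rpow_atTop hr).comp
        (tendsto_natCast_atTop_atTop.atTop_div_const (by norm_num))
    have h2 := (h1.const_mul_atTop (show 0 < D₁ * Real.exp (-3) by positivity)).atTop_div_const
      (show (0:ℝ) < 2 by norm_num)
    exact h2.eventually_gt_atTop 1
  have hev2 := ev_log K (r / p) (by positivity)
  have hev3 : ∀ᶠ n : ℕ in atTop, K ≤ (n:ℝ) :=
    tendsto_natCast_atTop_atTop.eventually_ge_atTop K
  obtain ⟨N, hN⟩ := eventually_atTop.1 (((hev1.and hev2).and hev3).and (eventually_ge_atTop 1))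
  refine ⟨2/5 * (D₁ * Real.exp (-3) / 12 * 2 ^ (-r)), by positivity, N, ?_⟩
  intro n hn
  obtain ⟨⟨⟨h1, h2⟩, h3⟩, hn1⟩ := hN n hn
  have hn0 : (0:ℝ) < n := by exact_mod_cast hn1
  obtain ⟨hs0, hM⟩ := hσ n hn1
  have hlow := delta_lower a r y D₁ hr hy hD₁ hb1 n hn1 (σ n) hs0 hM h1
  set δ := σ n - Real.log y with hδ
  have hδ0 : 0 < δ := by by_contra hc; push Not at hc; nlinarith
  have hup : (n:ℝ) * δ ^ p ≤ K := delta_upper a r y D₂ hy hD₂ hb2 p hp hp0 n (σ n) hs0 hM hδ0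
  have hup' : δ ^ p ≤ K / n := by rw [le_div_iff₀ hn0]; linarith
  have hδ1 : δ ≤ 1 := by
    have : δ ^ p ≤ 1 := hup'.trans (by rw [div_le_one hn0]; exact h3)
    exact (pow_le_one_iff_of_nonneg hδ0.le hp0).1 this
  have hL : δ ^ r * Real.log n ^ 2 ≤ 1/4 := by
    refine le_trans (mul_le_mul_of_nonneg_right ?_ (sq_nonneg _)) h2
    have : δ ^ r = (δ ^ p) ^ (r / p) := by
      rw [← Real.rpow_natCast, ← Real.rpow_mul hδ0.le]; congr 1; field_simp
    rw [this]
    exact Real.rpow_le_rpow (by positivity) hup' (by positivity)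
  have hlog : 0 ≤ Real.log n := Real.log_natCast_nonneg n
  set α₀ := δ ^ ((r + 2) / 2) * Real.log n with hα₀
  have hα0 : 0 ≤ α₀ := by positivity
  have hα0sq : α₀ ^ 2 = δ ^ (r + 2) * Real.log n ^ 2 := by
    rw [hα₀, mul_pow, ← Real.rpow_natCast, ← Real.rpow_mul hδ0.le]
    congr 2; push_cast; ring
  have hα0le : α₀ ≤ 1/2 := by
    have h4 : α₀ ^ 2 ≤ (1/2) ^ 2 := by
      rw [hα0sq]
      have : δ ^ (r + 2) ≤ δ ^ r := Real.rpow_le_rpow_of_exponent_ge hδ0 hδ1 (by linarith)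
      calc _ ≤ δ ^ r * Real.log n ^ 2 := by gcongr
        _ ≤ _ := by linarith
    exact le_of_sq_le_sq h4 (by norm_num)
  set m := ⌊1 / δ⌋₊ with hm
  have hmle : (m:ℝ) ≤ 1 / δ := Nat.floor_le (by positivity)
  have hmlt : 1 / δ < m + 1 := Nat.lt_floor_add_one _
  have hm1 : 1 ≤ m := by
    rw [hm, Nat.one_le_floor_iff, le_div_iff₀ hδ0]; linarith
  have hm1' : (1:ℝ) ≤ m := by exact_mod_cast hm1
  have hmδ : m * δ ≤ 1 := by rwa [le_div_iff₀ hδ0] at hmle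
  have hm2 : 1 / 2 * δ⁻¹ ≤ m := by rw [one_div] at hmlt; linarith
  have hmn : 3 * m ≤ n := by
    have : (3:ℝ) * m ≤ n := by
      by_contra hc; push Not at hc; nlinarith
    exact_mod_cast this
  have hE : ∀ α : ℝ, α₀ ≤ |α| → |α| ≤ 1/2 →
      ‖phi a n (σ n) α * Complex.exp (-(2 * Real.pi * Complex.I * α * n))‖ ≤
      Real.exp (-(2/5 * (D₁ * Real.exp (-3) / 12 * 2 ^ (-r))) * Real.log n ^ 2) := by
    intro α ha1 ha2
    have hnorm : ‖Complex.exp (-(2 * Real.pi * Complex.I * α * n))‖ = 1 := by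
      rw [show (-(2 * Real.pi * Complex.I * α * n) : ℂ) =
        ((-(2 * Real.pi * α * n) : ℝ) : ℂ) * Complex.I by push_cast; ring]
      exact Complex.norm_exp_ofReal_mul_I _
    rw [norm_mul, hnorm, mul_one]
    refine (phi_bound a n (σ n) α hs0).trans ?_
    rw [Real.exp_le_exp]
    have hx := exponent_lower a r y D₁ (σ n) |α| hr hy hD₁ hb1 n m hm1 hmn hmδ hδ0
      (abs_nonneg _) ha2
    have hkey : 2 ^ (-r) * Real.log n ^ 2 ≤
        (m:ℝ) ^ r * min (1/4) (4 * |α| ^ 2 * m ^ 2) := by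
      have hmr : 2 ^ (-r) * (δ ^ r)⁻¹ ≤ (m:ℝ) ^ r := by
        have := Real.rpow_le_rpow (by positivity) hm2 hr.le
        rw [Real.mul_rpow (by norm_num) (by positivity), Real.inv_rpow hδ0.le, one_div,
          Real.inv_rpow (by norm_num), ← Real.rpow_neg (by norm_num)] at this
        exact this
      have hδr : 0 < δ ^ r := Real.rpow_pos_of_pos hδ0 r
      have h2r : (0:ℝ) < 2 ^ (-r) := by positivity
      rw [mul_min_of_nonneg _ _ (by positivity)]
      refine le_min ?_ ?_
      · calc 2 ^ (-r) * Real.log n ^ 2 = 2 ^ (-r) * (δ ^ r)⁻¹ * (δ ^ r * Real.log n ^ 2) := by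
              field_simp
          _ ≤ _ := by gcongr
      · calc 2 ^ (-r) * Real.log n ^ 2
            = (2 ^ (-r) * (δ ^ r)⁻¹) * (4 * α₀ ^ 2 * (1 / 2 * δ⁻¹) ^ 2) := by
              rw [hα0sq, Real.rpow_add hδ0, Real.rpow_two]; field_simp; norm_num
          _ ≤ _ := by gcongr
    have := mul_le_mul_of_nonneg_left hkey (show 0 ≤ D₁ * Real.exp (-3) / 12 by positivity)
    linarith
  set E := Real.exp (-(2/5 * (D₁ * Real.exp (-3) / 12 * 2 ^ (-r))) * Real.log n ^ 2) with hEd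
  have hE0 : 0 < E := Real.exp_pos _
  have i1 := intervalIntegral.norm_integral_le_of_norm_le_const (a := (-(1/2) : ℝ)) (b := -α₀)
    (C := E) (f := fun α : ℝ => phi a n (σ n) α * Complex.exp (-(2 * Real.pi * Complex.I * α * n)))
    (by
      intro x hx
      rw [Set.uIoc_of_le (by linarith)] at hx
      have : |x| = -x := abs_of_nonpos (by linarith [hx.2])
      exact hE x (by rw [this]; linarith [hx.2]) (by rw [this]; linarith [hx.1]))
  have i2 := intervalIntegral.norm_integral_le_of_norm_le_const (a := α₀) (b := (1/2 : ℝ))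
    (C := E) (f := fun α : ℝ => phi a n (σ n) α * Complex.exp (-(2 * Real.pi * Complex.I * α * n)))
    (by
      intro x hx
      rw [Set.uIoc_of_le (by linarith)] at hx
      have : |x| = x := abs_of_nonneg (by linarith [hx.1])
      exact hE x (by rw [this]; linarith [hx.1]) (by rw [this]; linarith [hx.2]))
  rw [abs_of_nonneg (by linarith)] at i1 i2
  refine (norm_add_le _ _).trans ((add_le_add i1 i2).trans ?_)
  nlinarith
end
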